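/- (Lifting theorem for nonsmooth vector fields.) Assume X_0 ≡ 0 and that X_1,...,X_n have coefficients in C^{r-1}(cl(Ω)) and satisfy the Hörmander span condition of step r on Ω. Then for every x₀ ∈ Ω there exist a neighborhood U(x₀), an integer m, and vector fields of the form X̃_k = X_k + Σ_{j=1}^m u_{kj}(x,t) ∂/∂t_j (k = 1,...,n), defined for (x,t) ∈ U(x₀) × I where I is a neighborhood of 0 ∈ ℝ^m, which are free up to step r and such that the commutators {(X̃_[I])_{(x,t)} : |I| ≤ r} span ℝ^{p+m} at every (x,t) ∈ U(x₀) × I. Moreover, the functions u_{kj}(x,t) can be taken to be polynomials of degree at most r − 1. -/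

import Mathlib

open MeasureTheory Set Topology

noncomputable section

/-- Euclidean space `ℝ^p`. -/
abbrev E (p : ℕ) : Type := EuclideanSpace ℝ (Fin p)

instance (p : ℕ) : Nonempty (E p) := ⟨0⟩

section Core

variable {V : Type*} [NormedAddCommGroup V] [NormedSpace ℝ V]

/-- Commutator of two vector fields: `[X,Y] = (DY)·X - (DX)·Y`. -/
def vComm (X Y : V → V) : V → V :=
  fun x => fderiv ℝ Y x (X x) - fderiv ℝ X x (Y x)

/-- Left-iterated commutator `[X_{f 0},[X_{f 1},…,[X_{f (k-1)}, X_{f k}]…]]`. -/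
def iterComm {ι : Type*} (X : ι → V → V) : (k : ℕ) → (Fin (k + 1) → ι) → V → V
  | 0, f => X (f 0)
  | k + 1, f => vComm (X (f 0)) (iterComm X k (fun j => f j.succ))

/-- Multiindices of length between `1` and `r` with entries in `ι`. -/
def MIdx (ι : Type*) (r : ℕ) : Type _ := Σ k : Fin r, (Fin (k.1 + 1) → ι)

instance (ι : Type*) [Fintype ι] (r : ℕ) : Fintype (MIdx ι r) := by
  unfold MIdx; infer_instance

/-- Weight `|I|` of a multiindex relative to a weight function `w`. -/
def wtOf {ι : Type*} (w : ι → ℕ) {r : ℕ} (I : MIdx ι r) : ℕ := ∑ j, w (I.2 j)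

/-- The iterated commutator `X_{[I]}` of a multiindex `I`. -/
def commOf {ι : Type*} (X : ι → V → V) {r : ℕ} (I : MIdx ι r) : V → V :=
  iterComm X I.1.1 I.2

/-- Standard weights: `X_0` has weight `2`, all the other fields weight `1`. -/
def wgt {n : ℕ} : Fin (n + 1) → ℕ := fun i => if i = 0 then 2 else 1

/-- Hörmander's condition of weighted step `r` on the set `S`: the commutators
`X_{[I]}` with `|I| ≤ r` span the whole space at every point of `S`. -/
def HormSpan {ι : Type*} (X : ι → V → V) (w : ι → ℕ) (r : ℕ) (S : Set V) : Prop :=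
  ∀ x ∈ S, Submodule.span ℝ {v : V | ∃ I : MIdx ι r, wtOf w I ≤ r ∧ v = commOf X I x} = ⊤

end Core

section Dist

variable {V : Type*} [NormedAddCommGroup V] [NormedSpace ℝ V] [CompleteSpace V]

/-- `φ` is an admissible curve of class `C(δ)` (for the subelliptic distance `d`)
inside `S`, joining `x` to `y`: it is an (absolutely continuous) integral of
`∑_{|I| ≤ r} a_I(t) (X_{[I]})_{φ(t)}` with `|a_I| ≤ δ^{|I|}`. -/
def IsAdmissible {ι : Type*} [Fintype ι] {r : ℕ} (X : ι → V → V) (w : ι → ℕ)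
    (S : Set V) (δ : ℝ) (x y : V) (φ : ℝ → V) : Prop :=
  ∃ a : MIdx ι r → ℝ → ℝ,
    (∀ t ∈ Icc (0:ℝ) 1, φ t ∈ S) ∧ φ 0 = x ∧ φ 1 = y ∧
    (∀ I, Measurable (a I)) ∧
    (∀ I, ∀ t ∈ Icc (0:ℝ) 1, |a I t| ≤ δ ^ wtOf w I) ∧
    (∀ I : MIdx ι r, r < wtOf w I → ∀ t, a I t = 0) ∧
    ∀ t ∈ Icc (0:ℝ) 1,
      φ t = x + ∫ s in (0:ℝ)..t, ∑ I : MIdx ι r, a I s • commOf X I (φ s)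

/-- The subelliptic (Nagel–Stein–Wainger) distance `d` attached to the system `X`. -/
def dCC {ι : Type*} [Fintype ι] (X : ι → V → V) (w : ι → ℕ) (r : ℕ)
    (S : Set V) (x y : V) : ℝ :=
  sInf {δ : ℝ | 0 < δ ∧ ∃ φ : ℝ → V, IsAdmissible (r := r) X w S δ x y φ}

/-- Metric ball of the subelliptic distance `d`. -/
def BCC {ι : Type*} [Fintype ι] (X : ι → V → V) (w : ι → ℕ) (r : ℕ)
    (S : Set V) (x : V) (ρ : ℝ) : Set V :=
  {y | dCC X w r S x y < ρ}

/-- `φ` is an admissible curve of class `C_1(δ)` (for the control distance `d_1`)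
inside `S`, joining `x` to `y`: `φ' = ∑_i a_i(t) (X_i)_{φ(t)}` with `|a_i| ≤ δ^{p_i}`. -/
def IsCtrlAdmissible {ι : Type*} [Fintype ι] (X : ι → V → V) (w : ι → ℕ)
    (S : Set V) (δ : ℝ) (x y : V) (φ : ℝ → V) : Prop :=
  ∃ a : ι → ℝ → ℝ,
    (∀ t ∈ Icc (0:ℝ) 1, φ t ∈ S) ∧ φ 0 = x ∧ φ 1 = y ∧
    (∀ i, Measurable (a i)) ∧
    (∀ i, ∀ t ∈ Icc (0:ℝ) 1, |a i t| ≤ δ ^ w i) ∧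
    ∀ t ∈ Icc (0:ℝ) 1,
      φ t = x + ∫ s in (0:ℝ)..t, ∑ i, a i s • X i (φ s)

/-- The control distance `d_1` attached to the system `X`. -/
def dCtrl {ι : Type*} [Fintype ι] (X : ι → V → V) (w : ι → ℕ)
    (S : Set V) (x y : V) : ℝ :=
  sInf {δ : ℝ | 0 < δ ∧ ∃ φ : ℝ → V, IsCtrlAdmissible X w S δ x y φ}

/-- Metric ball of the control distance `d_1`. -/
def BCtrl {ι : Type*} [Fintype ι] (X : ι → V → V) (w : ι → ℕ)
    (S : Set V) (x : V) (ρ : ℝ) : Set V :=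
  {y | dCtrl X w S x y < ρ}

/-- `x` and `y` are joined, within `W`, by a curve composed of a finite number of
arcs of integral curves of the vector fields `X_i`. -/
def IsIntegralArcChain {ι : Type*} (X : ι → V → V) (W : Set V) (x y : V) : Prop :=
  ∃ N : ℕ, ∃ z : Fin (N + 1) → V, z 0 = x ∧ z (Fin.last N) = y ∧
    ∀ j : Fin N, ∃ (i : ι) (c : ℝ) (γ : ℝ → V),
      γ 0 = z j.castSucc ∧ γ 1 = z j.succ ∧ (∀ t ∈ Icc (0:ℝ) 1, γ t ∈ W) ∧
      ∀ t ∈ Icc (0:ℝ) 1, HasDerivAt γ (c • X i (γ t)) t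

end Dist

/-- The Taylor-polynomial vector field of degree `m` centered at `x₀` which
approximates `Xi` (derivatives taken within `S`). -/
def taylorVF {p : ℕ} (Xi : E p → E p) (S : Set (E p)) (m : ℕ) (x₀ : E p) : E p → E p :=
  fun x => ∑ k ∈ Finset.range (m + 1),
    (k.factorial : ℝ)⁻¹ • iteratedFDerivWithin ℝ k Xi S x₀ (fun _ => x - x₀)

section Exp

variable {V : Type*} [NormedAddCommGroup V] [NormedSpace ℝ V] [CompleteSpace V]

open scoped Classical in
/-- `expVF X x = exp(X)(x)`: the time-one value of an integral curve of `X`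
issued from `x` (chosen by choice; under Lipschitz assumptions this is the
unique flow). -/
def expVF (X : V → V) (x : V) : V :=
  if h : ∃ φ : ℝ → V, φ 0 = x ∧ ∀ t ∈ Icc (0:ℝ) 1, φ t = x + ∫ s in (0:ℝ)..t, X (φ s)
  then h.choose 1 else x

/-- The maps `𝒞_l(t_1,…,t_l)` built from exponentials of the fields
`X_{f 0},…,X_{f k}` with independent parameters `t_0,…,t_k`. -/
def mqExp {ι : Type*} (X : ι → V → V) :
    (k : ℕ) → (Fin (k + 1) → ι) → (Fin (k + 1) → ℝ) → V → V
  | 0, f, t => expVF (fun y => t 0 • X (f 0) y)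
  | k + 1, f, t => fun x =>
      haveI : Nonempty V := ⟨0⟩
      Function.invFun (mqExp X k (fun j => f j.succ) (fun j => t j.succ))
        (expVF (fun y => (-(t 0)) • X (f 0) y)
          (mqExp X k (fun j => f j.succ) (fun j => t j.succ)
            (expVF (fun y => t 0 • X (f 0) y) x)))

/-- The iterated mixed derivative `∂^l G/∂t_1⋯∂t_l` at the origin. -/
def mixedDeriv : (l : ℕ) → ((Fin l → ℝ) → V → V) → V → V
  | 0, G => G (fun i => i.elim0)
  | l + 1, G => mixedDeriv l (fun t x => deriv (fun s : ℝ => G (Fin.cons s t) x) 0)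

/-- The quasiexponential map `C_{ℓ(I)}(t, X_I)`. -/
def qExpOf {ι : Type*} (X : ι → V → V) (w : ι → ℕ) (t : ℝ) {r : ℕ} (I : MIdx ι r) : V → V :=
  mqExp X I.1.1 I.2 (fun j => t ^ w (I.2 j))

/-- The map `E_I(t)`. -/
def Emap {ι : Type*} (X : ι → V → V) (w : ι → ℕ) {r : ℕ} (I : MIdx ι r)
    (t : ℝ) : V → V :=
  haveI : Nonempty V := ⟨0⟩
  if 0 ≤ t then qExpOf X w (Real.rpow t ((wtOf w I : ℝ))⁻¹) I
  else Function.invFun (qExpOf X w (Real.rpow |t| ((wtOf w I : ℝ))⁻¹) I)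

end Exp

/-- The map `E_η^X(x,h) = E_{I_1}(h_1) E_{I_2}(h_2) ⋯ E_{I_p}(h_p)(x)`. -/
def EmapFam {p : ℕ} {ι : Type*} {r : ℕ} (X : ι → E p → E p) (w : ι → ℕ)
    (η : Fin p → MIdx ι r) (x : E p) (h : Fin p → ℝ) : E p :=
  (List.ofFn fun j : Fin p => Emap X w (η j) (h j)).foldr (fun f y => f y) x

/-- `λ_η(x)`: the determinant of the `p × p` matrix whose rows are the
commutators `(X_{[I_j]})_x`, `I_j ∈ η`. -/
def lamDet {p : ℕ} {ι : Type*} {r : ℕ} (X : ι → E p → E p) (η : Fin p → MIdx ι r)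
    (x : E p) : ℝ :=
  Matrix.det (Matrix.of fun j k => commOf X (η j) x k)

/-- The differential operator `X_i` acting on a scalar function. -/
def Xop {p : ℕ} (Xi : E p → E p) (f : E p → ℝ) (y : E p) : ℝ := fderiv ℝ f y (Xi y)

/-- `|Xf(y)| = (∑_i |X_i f(y)|²)^{1/2}`. -/
def gradLen {p n : ℕ} (X : Fin n → E p → E p) (f : E p → ℝ) (y : E p) : ℝ :=
  Real.sqrt (∑ i, (Xop (X i) f y) ^ 2)

/-- The formal adjoint `X_i^*` acting on a scalar function:
`X_i^* f = -∑_j ∂_{y_j} (b_{ij} f)`. -/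
def XstarOp {p : ℕ} (Xi : E p → E p) (f : E p → ℝ) (y : E p) : ℝ :=
  - ∑ j, fderiv ℝ (fun z => Xi z j * f z) y (EuclideanSpace.single j 1)

section Free

/-- Left-iterated bracket in the free Lie algebra on `n` generators. -/
def freeBracket {n : ℕ} : (k : ℕ) → (Fin (k + 1) → Fin n) → FreeLieAlgebra ℝ (Fin n)
  | 0, f => FreeLieAlgebra.of ℝ (f 0)
  | k + 1, f => ⁅FreeLieAlgebra.of ℝ (f 0), freeBracket k (fun j => f j.succ)⁆

/-- The free bracket associated to a multiindex. -/
def freeBracketOf {n r : ℕ} (I : MIdx (Fin n) r) : FreeLieAlgebra ℝ (Fin n) :=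
  freeBracket I.1.1 I.2

/-- Submodule of the free Lie algebra spanned by left-iterated brackets of
length `> r`. -/
def longBrackets (n r : ℕ) : Submodule ℝ (FreeLieAlgebra ℝ (Fin n)) :=
  Submodule.span ℝ {z | ∃ k : ℕ, r ≤ k ∧ ∃ f : Fin (k + 1) → Fin n, z = freeBracket k f}

/-- The system `X` is free up to step `r` on `S`: every linear relation among
the iterated commutators of length `≤ r` at a point of `S` follows from
anticommutativity and the Jacobi identity (i.e. it already holds in the free
nilpotent Lie algebra of step `r`). -/
def FreeUpTo {V : Type*} [NormedAddCommGroup V] [NormedSpace ℝ V] {n : ℕ}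
    (X : Fin n → V → V) (r : ℕ) (S : Set V) : Prop :=
  ∀ x ∈ S, ∀ c : MIdx (Fin n) r → ℝ,
    (∑ I, c I • commOf X I x) = 0 →
    (∑ I, c I • freeBracketOf I) ∈ longBrackets n r

end Free

namespace Lifting

section FreeAssociative

attribute [local instance] LieRing.ofAssociativeRing

variable {n : ℕ}

/-- The noncommutative monomial attached to a word. -/
def word (w : List (Fin n)) : FreeAlgebra ℝ (Fin n) := (w.map (FreeAlgebra.ι ℝ)).prod

@[simp] lemma word_nil : word ([] : List (Fin n)) = 1 := rfl

@[simp] lemma word_cons (i : Fin n) (w : List (Fin n)) :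
    word (i :: w) = FreeAlgebra.ι ℝ i * word w := by simp [word]

lemma word_append (v w : List (Fin n)) : word (v ++ w) = word v * word w := by simp [word]

lemma word_concat (w : List (Fin n)) (i : Fin n) :
    word (w ++ [i]) = word w * FreeAlgebra.ι ℝ i := by simp [word]

/-- The words form a basis of the free associative algebra. -/
def wordBasis (n : ℕ) : Module.Basis (List (Fin n)) ℝ (FreeAlgebra ℝ (Fin n)) :=
  FreeAlgebra.basisFreeMonoid ℝ (Fin n)

@[simp] lemma wordBasis_apply (w : List (Fin n)) : wordBasis n w = word w := by
  change FreeAlgebra.equivMonoidAlgebraFreeMonoid.symm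
    (MonoidAlgebra.single (FreeMonoid.ofList w) 1) = _
  rw [AlgEquiv.symm_apply_eq]
  induction w with
  | nil => simp; rfl
  | cons i w ih =>
    rw [word_cons, map_mul, ← ih, FreeMonoid.ofList_cons]
    simp [FreeAlgebra.equivMonoidAlgebraFreeMonoid]

/-- A linear map prescribed on words. -/
def wordLift {M : Type*} [AddCommGroup M] [Module ℝ M] (g : List (Fin n) → M) :
    FreeAlgebra ℝ (Fin n) →ₗ[ℝ] M := (wordBasis n).constr ℝ g

@[simp] lemma wordLift_word {M : Type*} [AddCommGroup M] [Module ℝ M] (g : List (Fin n) → M)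
    (w : List (Fin n)) : wordLift g (word w) = g w := by
  rw [← wordBasis_apply]; exact (wordBasis n).constr_basis ℝ g w

lemma linearMap_ext_word {M : Type*} [AddCommGroup M] [Module ℝ M]
    {f g : FreeAlgebra ℝ (Fin n) →ₗ[ℝ] M} (h : ∀ w, f (word w) = g (word w)) : f = g :=
  (wordBasis n).ext fun w => by simpa using h w

/-- Homogeneous elements of degree `k`. -/
def homog (n k : ℕ) : Submodule ℝ (FreeAlgebra ℝ (Fin n)) :=
  Submodule.span ℝ (word '' {w | w.length = k})

lemma word_mem_homog (w : List (Fin n)) : word w ∈ homog n w.length :=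
  Submodule.subset_span ⟨w, rfl, rfl⟩

lemma ι_mem_homog (i : Fin n) : FreeAlgebra.ι ℝ i ∈ homog n 1 := by
  simpa using word_mem_homog [i]

lemma mul_mem_homog {j k : ℕ} {x y : FreeAlgebra ℝ (Fin n)} (hx : x ∈ homog n j)
    (hy : y ∈ homog n k) : x * y ∈ homog n (j + k) := by
  have h : homog n j * homog n k ≤ homog n (j + k) := by
    rw [homog, homog, Submodule.span_mul_span, Submodule.span_le]
    rintro _ ⟨_, ⟨v, hv, rfl⟩, _, ⟨w, hw, rfl⟩, rfl⟩
    simp only [mem_ofPred_eq] at hv hw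
    subst hv hw
    simpa [word_append] using word_mem_homog (v ++ w)
  exact h (Submodule.mul_mem_mul hx hy)

/-- Projection onto the homogeneous elements of degree `k`. -/
def homogProj (k : ℕ) : FreeAlgebra ℝ (Fin n) →ₗ[ℝ] FreeAlgebra ℝ (Fin n) :=
  wordLift fun w => if w.length = k then word w else 0

lemma homogProj_of_mem {j : ℕ} (k : ℕ) {x : FreeAlgebra ℝ (Fin n)} (hx : x ∈ homog n j) :
    homogProj k x = if j = k then x else 0 := by
  induction hx using Submodule.span_induction with
  | mem x hx =>
    obtain ⟨w, hw, rfl⟩ := hx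
    simp only [mem_ofPred_eq] at hw
    simp [homogProj, hw]
  | zero => simp
  | add x y _ _ hx hy => rw [map_add, hx, hy]; split_ifs <;> simp
  | smul a x _ hx => rw [map_smul, hx]; split_ifs <;> simp

/-- The coefficient (on the left) of the words ending with the letter `i`. -/
def stripLast (i : Fin n) : FreeAlgebra ℝ (Fin n) →ₗ[ℝ] FreeAlgebra ℝ (Fin n) :=
  wordLift fun w => if w.getLast? = some i then word w.dropLast else 0

lemma stripLast_mul_ι (i j : Fin n) (y : FreeAlgebra ℝ (Fin n)) :
    stripLast i (y * FreeAlgebra.ι ℝ j) = if j = i then y else 0 := by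
  have h : (stripLast i) ∘ₗ (LinearMap.mulRight ℝ (FreeAlgebra.ι ℝ j)) =
      if j = i then LinearMap.id else 0 := by
    refine linearMap_ext_word fun w => ?_
    rw [LinearMap.comp_apply, LinearMap.mulRight_apply, ← word_concat]
    split_ifs with h <;> simp [stripLast, h]
  have := LinearMap.congr_fun h y
  split_ifs at this ⊢ <;> simpa using this

lemma eq_smul_one_of_stripLast_eq_zero {a : FreeAlgebra ℝ (Fin n)}
    (h : ∀ i, stripLast i a = 0) : ∃ c : ℝ, a = c • 1 := by
  have key : LinearMap.id = (LinearMap.toSpanSingleton ℝ (FreeAlgebra ℝ (Fin n)) 1) ∘ₗ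
      (wordLift fun w => if w = [] then (1 : ℝ) else 0) +
      ∑ i, (LinearMap.mulRight ℝ (FreeAlgebra.ι ℝ i)) ∘ₗ (stripLast i) := by
    refine linearMap_ext_word fun w => ?_
    rcases List.eq_nil_or_concat w with rfl | ⟨w, j, rfl⟩
    · simp [stripLast, -word_nil]
      rfl
    · have h1 : ∀ i, stripLast i (word (w ++ [j])) = if j = i then word w else 0 := fun i => by
        rw [word_concat, stripLast_mul_ι]
      simp [LinearMap.sum_apply, h1, ite_mul, ← word_concat w j]
  have h2 := LinearMap.congr_fun key a
  refine ⟨wordLift (fun w => if w = [] then (1 : ℝ) else 0) a, ?_⟩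
  simpa [LinearMap.sum_apply, h] using h2

/-- Left-iterated bracket in the free associative algebra. -/
def assocBracket : (k : ℕ) → (Fin (k + 1) → Fin n) → FreeAlgebra ℝ (Fin n)
  | 0, f => FreeAlgebra.ι ℝ (f 0)
  | k + 1, f => FreeAlgebra.ι ℝ (f 0) * assocBracket k (fun j => f j.succ) -
      assocBracket k (fun j => f j.succ) * FreeAlgebra.ι ℝ (f 0)

lemma assocBracket_mem_homog (k : ℕ) (f : Fin (k + 1) → Fin n) :
    assocBracket k f ∈ homog n (k + 1) := by
  induction k with
  | zero => exact ι_mem_homog _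
  | succ k ih =>
    refine sub_mem ?_ (mul_mem_homog (ih _) (ι_mem_homog _))
    have h := mul_mem_homog (ι_mem_homog (f 0)) (ih fun j => f j.succ)
    rwa [add_comm 1 (k + 1)] at h

lemma stripLast_mul_assocBracket (i : Fin n) (k : ℕ) (f : Fin (k + 1) → Fin n)
    (x : FreeAlgebra ℝ (Fin n)) :
    stripLast i (x * assocBracket k f) = x * stripLast i (assocBracket k f) := by
  induction k generalizing x with
  | zero =>
    have h := stripLast_mul_ι i (f 0) 1
    rw [one_mul] at h
    simp only [assocBracket, stripLast_mul_ι, h]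
    split_ifs <;> simp
  | succ k ih =>
    simp only [assocBracket, mul_sub, map_sub, ← mul_assoc, stripLast_mul_ι, ih]
    split_ifs <;> simp

/-- The canonical morphism from the free Lie algebra to the free associative algebra. -/
def toAssoc (n : ℕ) : FreeLieAlgebra ℝ (Fin n) →ₗ⁅ℝ⁆ FreeAlgebra ℝ (Fin n) :=
  FreeLieAlgebra.lift ℝ (FreeAlgebra.ι ℝ)

lemma toAssoc_freeBracket (k : ℕ) (f : Fin (k + 1) → Fin n) :
    toAssoc n (freeBracket k f) = assocBracket k f := by
  induction k with
  | zero => simp [toAssoc, freeBracket, assocBracket]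
  | succ k ih =>
    rw [freeBracket, LieHom.map_lie, ih, assocBracket, LieRing.of_associative_ring_bracket]
    simp [toAssoc]

/-- The adjoint action of the free associative algebra on the free Lie algebra. -/
def adAction (n : ℕ) :
    FreeAlgebra ℝ (Fin n) →ₐ[ℝ] Module.End ℝ (FreeLieAlgebra ℝ (Fin n)) :=
  FreeAlgebra.lift ℝ fun i => LieAlgebra.ad ℝ _ (FreeLieAlgebra.of ℝ i)

lemma adAction_assocBracket (k : ℕ) (f : Fin (k + 1) → Fin n) :
    adAction n (assocBracket k f) = LieAlgebra.ad ℝ _ (freeBracket k f) := by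
  induction k with
  | zero => simp [adAction, freeBracket, assocBracket]
  | succ k ih =>
    rw [freeBracket, LieHom.map_lie, ← ih, assocBracket, LieRing.of_associative_ring_bracket,
      map_sub, map_mul, map_mul]
    simp [adAction]

/-- The Dynkin map, sending a word to the corresponding left-iterated bracket. -/
def dynkin (n : ℕ) : FreeAlgebra ℝ (Fin n) →ₗ[ℝ] FreeLieAlgebra ℝ (Fin n) :=
  ∑ i, (LinearMap.applyₗ (FreeLieAlgebra.of ℝ i)) ∘ₗ (adAction n).toLinearMap ∘ₗ stripLast i

lemma dynkin_apply (a : FreeAlgebra ℝ (Fin n)) :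
    dynkin n a = ∑ i, adAction n (stripLast i a) (FreeLieAlgebra.of ℝ i) := by
  simp [dynkin, LinearMap.sum_apply]

lemma dynkin_mul_ι (x : FreeAlgebra ℝ (Fin n)) (j : Fin n) :
    dynkin n (x * FreeAlgebra.ι ℝ j) = adAction n x (FreeLieAlgebra.of ℝ j) := by
  rw [dynkin_apply, Finset.sum_eq_single j]
  · simp [stripLast_mul_ι]
  · intro i _ hi
    simp [stripLast_mul_ι, hi.symm]
  · simp

/-- Dynkin–Specht–Wever: the Dynkin map multiplies brackets by their length. -/
lemma dynkin_assocBracket (k : ℕ) (f : Fin (k + 1) → Fin n) :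
    dynkin n (assocBracket k f) = ((k : ℝ) + 1) • freeBracket k f := by
  induction k with
  | zero =>
    have h := dynkin_mul_ι (1 : FreeAlgebra ℝ (Fin n)) (f 0)
    simpa [assocBracket, freeBracket] using h
  | succ k ih =>
    have h : dynkin n (FreeAlgebra.ι ℝ (f 0) * assocBracket k (fun j => f j.succ)) =
        adAction n (FreeAlgebra.ι ℝ (f 0)) (dynkin n (assocBracket k (fun j => f j.succ))) := by
      simp only [dynkin_apply, stripLast_mul_assocBracket, map_mul, map_sum, Module.End.mul_apply]
    rw [assocBracket, map_sub, h, ih, dynkin_mul_ι, adAction_assocBracket, freeBracket]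
    simp only [adAction, FreeAlgebra.lift_ι_apply, map_smul, LieAlgebra.ad_apply]
    rw [← lie_skew (FreeLieAlgebra.of ℝ (f 0)) (freeBracket k _)]
    push_cast
    module

/-- Multiindices of arbitrary positive length. -/
abbrev Idx (n : ℕ) : Type := Σ k : ℕ, (Fin (k + 1) → Fin n)

/-- The length of a multiindex. -/
def Idx.len (I : Idx n) : ℕ := I.1 + 1

/-- The associative bracket of a multiindex. -/
def Idx.assoc (I : Idx n) : FreeAlgebra ℝ (Fin n) := assocBracket I.1 I.2

lemma Idx.one_le_len (I : Idx n) : 1 ≤ I.len := Nat.le_add_left _ _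

lemma Idx.assoc_mem_homog (I : Idx n) : I.assoc ∈ homog n I.len := assocBracket_mem_homog _ _

/-- A combination of brackets whose associative image is a constant vanishes in the free
Lie algebra. -/
lemma linearCombination_freeBracket_eq_zero (c : Idx n →₀ ℝ)
    (h : ∀ i, stripLast i (Finsupp.linearCombination ℝ Idx.assoc c) = 0) :
    Finsupp.linearCombination ℝ (fun I : Idx n => freeBracket I.1 I.2) c = 0 := by
  obtain ⟨a, ha⟩ := eq_smul_one_of_stripLast_eq_zero h
  have hk : ∀ k : ℕ, c.sum (fun I b => if I.1 = k then b • freeBracket I.1 I.2 else 0) = 0 := by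
    intro k
    have h1 : dynkin n (homogProj (k + 1) (Finsupp.linearCombination ℝ Idx.assoc c)) = 0 := by
      have h0 : (1 : FreeAlgebra ℝ (Fin n)) ∈ homog n 0 := word_mem_homog []
      rw [ha, map_smul, homogProj_of_mem _ h0]
      simp
    have h2 : ((k : ℝ) + 1) •
        c.sum (fun I b => if I.1 = k then b • freeBracket I.1 I.2 else 0) = 0 := by
      refine Eq.trans ?_ h1
      rw [Finsupp.linearCombination_apply, Finsupp.sum, Finsupp.sum, Finset.smul_sum,
        map_sum, map_sum]
      refine Finset.sum_congr rfl fun I _ => ?_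
      rw [map_smul, homogProj_of_mem _ I.assoc_mem_homog, map_smul]
      by_cases hI : I.1 = k
      · subst hI
        simp only [Idx.len, Idx.assoc, if_true, dynkin_assocBracket]
        exact smul_comm _ _ _
      · simp [Idx.len, hI]
    exact (smul_eq_zero.1 h2).resolve_left (by positivity)
  have h3 : ∑ k ∈ c.support.image Sigma.fst,
      c.sum (fun I b => if I.1 = k then b • freeBracket I.1 I.2 else 0) = 0 :=
    Finset.sum_eq_zero fun k _ => hk k
  rw [← h3, Finsupp.linearCombination_apply]
  simp only [Finsupp.sum]
  rw [Finset.sum_comm]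
  refine Finset.sum_congr rfl fun I hI => ?_
  rw [Finset.sum_ite_eq, if_pos (Finset.mem_image_of_mem _ hI)]

end FreeAssociative

section OrderedMonomials

variable {n : ℕ}

/-- The span of the brackets of length `k`. -/
def bracketSpan (n k : ℕ) : Submodule ℝ (FreeAlgebra ℝ (Fin n)) :=
  Submodule.span ℝ (Idx.assoc '' {I : Idx n | I.len = k})

lemma ι_commutator_mem_bracketSpan (i : Fin n) {k : ℕ} {x : FreeAlgebra ℝ (Fin n)}
    (hx : x ∈ bracketSpan n k) :
    FreeAlgebra.ι ℝ i * x - x * FreeAlgebra.ι ℝ i ∈ bracketSpan n (k + 1) := by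
  induction hx using Submodule.span_induction with
  | mem x hx =>
    obtain ⟨⟨j, f⟩, rfl, rfl⟩ := hx
    exact Submodule.subset_span ⟨⟨j + 1, Fin.cons i f⟩, rfl, rfl⟩
  | zero => simp
  | add x y _ _ hx hy => convert add_mem hx hy using 1; noncomm_ring
  | smul c x _ hx =>
    convert Submodule.smul_mem _ c hx using 1
    rw [mul_smul_comm, smul_mul_assoc, smul_sub]

lemma assocBracket_commutator_mem_bracketSpan (k : ℕ) (f : Fin (k + 1) → Fin n) {j : ℕ}
    {x : FreeAlgebra ℝ (Fin n)} (hx : x ∈ bracketSpan n j) :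
    assocBracket k f * x - x * assocBracket k f ∈ bracketSpan n (k + 1 + j) := by
  induction k generalizing j x with
  | zero =>
    have h := ι_commutator_mem_bracketSpan (f 0) hx
    rwa [add_comm j 1] at h
  | succ k ih =>
    have h1 := ι_commutator_mem_bracketSpan (f 0) (ih (fun j => f j.succ) hx)
    have h2 := ih (fun j => f j.succ) (ι_commutator_mem_bracketSpan (f 0) hx)
    rw [show k + 1 + (j + 1) = k + 1 + j + 1 by ring] at h2
    have h3 := sub_mem h1 h2
    rw [show k + 1 + j + 1 = k + 1 + 1 + j by ring] at h3
    convert h3 using 1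
    simp only [assocBracket]
    noncomm_ring

lemma assoc_commutator_mem_bracketSpan (I J : Idx n) :
    I.assoc * J.assoc - J.assoc * I.assoc ∈ bracketSpan n (I.len + J.len) :=
  assocBracket_commutator_mem_bracketSpan I.1 I.2 (Submodule.subset_span ⟨J, rfl, rfl⟩)

variable {κ : Type*} (a : κ → Idx n)

/-- The product of the brackets listed in `l`. -/
def listProd (l : List κ) : FreeAlgebra ℝ (Fin n) := (l.map fun x => (a x).assoc).prod

/-- The total length of the brackets listed in `l`. -/
def listWt (l : List κ) : ℕ := (l.map fun x => (a x).len).sum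

@[simp] lemma listProd_nil : listProd a [] = 1 := rfl

@[simp] lemma listProd_cons (x : κ) (l : List κ) :
    listProd a (x :: l) = (a x).assoc * listProd a l := by simp [listProd]

@[simp] lemma listWt_nil : listWt a [] = 0 := rfl

@[simp] lemma listWt_cons (x : κ) (l : List κ) :
    listWt a (x :: l) = (a x).len + listWt a l := by simp [listWt]

lemma listWt_perm {l l' : List κ} (h : l.Perm l') : listWt a l = listWt a l' :=
  (h.map _).sum_eq

lemma length_le_listWt (l : List κ) : l.length ≤ listWt a l := by
  induction l with
  | nil => simp
  | cons x l ih =>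
    have := (a x).one_le_len
    simp only [List.length_cons, listWt_cons]
    lia

lemma listProd_mem_homog (l : List κ) : listProd a l ∈ homog n (listWt a l) := by
  induction l with
  | nil => exact word_mem_homog []
  | cons x l ih =>
    rw [listProd_cons, listWt_cons]
    exact mul_mem_homog (a x).assoc_mem_homog ih

/-- The span of the products of at most `j` brackets of total length `w`. -/
def prodSpan (j w : ℕ) : Submodule ℝ (FreeAlgebra ℝ (Fin n)) :=
  Submodule.span ℝ (listProd a '' {l | l.length ≤ j ∧ listWt a l = w})

/-- The generators of degree `k` drawn from the family `a`. -/
def genSpan (k : ℕ) : Submodule ℝ (FreeAlgebra ℝ (Fin n)) :=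
  Submodule.span ℝ ((fun x => (a x).assoc) '' {x | (a x).len = k})

variable {a}

lemma mul_mem_prodSpan {j k w : ℕ} {x y : FreeAlgebra ℝ (Fin n)} (hx : x ∈ genSpan a k)
    (hy : y ∈ prodSpan a j w) : x * y ∈ prodSpan a (j + 1) (k + w) := by
  have h : genSpan a k * prodSpan a j w ≤ prodSpan a (j + 1) (k + w) := by
    rw [genSpan, prodSpan, Submodule.span_mul_span, Submodule.span_le]
    rintro _ ⟨_, ⟨x, hx, rfl⟩, _, ⟨l, ⟨hl, hl'⟩, rfl⟩, rfl⟩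
    refine Submodule.subset_span ⟨x :: l, ⟨by simpa using hl, ?_⟩, by simp⟩
    rw [listWt_cons, hl', hx]
  exact h (Submodule.mul_mem_mul hx hy)

lemma assoc_mem_genSpan (x : κ) : (a x).assoc ∈ genSpan a (a x).len :=
  Submodule.subset_span ⟨x, rfl, rfl⟩

lemma listProd_mem_prodSpan (l : List κ) : listProd a l ∈ prodSpan a l.length (listWt a l) :=
  Submodule.subset_span ⟨l, ⟨le_rfl, rfl⟩, rfl⟩

variable {d : ℕ}

lemma assoc_mem_genSpan_of_le
    (hB : ∀ I : Idx n, I.len ≤ d → I.assoc ∈ Submodule.span ℝ (range fun x => (a x).assoc))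
    {I : Idx n} (hI : I.len ≤ d) : I.assoc ∈ genSpan a I.len := by
  have h1 : homogProj I.len I.assoc ∈
      (Submodule.span ℝ (range fun x => (a x).assoc)).map (homogProj I.len) :=
    Submodule.mem_map_of_mem (hB I hI)
  rw [homogProj_of_mem _ I.assoc_mem_homog, if_pos rfl, Submodule.map_span] at h1
  refine Submodule.span_le.2 ?_ h1
  rintro _ ⟨_, ⟨x, rfl⟩, rfl⟩
  simp only [SetLike.mem_coe]
  rw [homogProj_of_mem _ (a x).assoc_mem_homog]
  split_ifs with h
  · exact Submodule.subset_span ⟨x, h, rfl⟩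
  · exact zero_mem _

lemma bracketSpan_le_genSpan
    (hB : ∀ I : Idx n, I.len ≤ d → I.assoc ∈ Submodule.span ℝ (range fun x => (a x).assoc))
    {k : ℕ} (hk : k ≤ d) : bracketSpan n k ≤ genSpan a k := by
  rw [bracketSpan, Submodule.span_le]
  rintro _ ⟨I, rfl, rfl⟩
  exact assoc_mem_genSpan_of_le hB hk

/-- Reordering the factors of a product only creates products with fewer factors. -/
lemma listProd_sub_mem_of_perm
    (hB : ∀ I : Idx n, I.len ≤ d → I.assoc ∈ Submodule.span ℝ (range fun x => (a x).assoc))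
    {l l' : List κ} (h : l.Perm l') (j : ℕ) (hj : l.length ≤ j + 1)
    (hd : listWt a l ≤ d) : listProd a l - listProd a l' ∈ prodSpan a j (listWt a l) := by
  induction h generalizing j with
  | nil => simp
  | cons x h ih =>
    rename_i l l'
    simp only [List.length_cons, listWt_cons, listProd_cons] at *
    rcases j with _ | j
    · have hl : l = [] := List.eq_nil_of_length_eq_zero (by lia)
      subst hl
      simp [h.symm.eq_nil]
    · rw [← mul_sub]
      exact mul_mem_prodSpan (assoc_mem_genSpan x) (ih j (by lia) (by lia))
  | swap x y l =>
    simp only [List.length_cons, listWt_cons, listProd_cons] at *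
    rw [← mul_assoc, ← mul_assoc, ← sub_mul, ← add_assoc]
    have h1 := bracketSpan_le_genSpan hB (by lia)
      (assoc_commutator_mem_bracketSpan (a y) (a x))
    have h2 := mul_mem_prodSpan h1 (listProd_mem_prodSpan l)
    refine Submodule.span_mono (image_mono ?_) h2
    rintro m ⟨hm, hm'⟩
    exact ⟨by lia, hm'⟩
  | trans h1 h2 ih1 ih2 =>
    rename_i l₁ l₂ l₃
    have e := listWt_perm a h1
    have h3 := ih2 j (by rw [← h1.length_eq]; exact hj) (by lia)
    rw [← e] at h3
    simpa using add_mem (ih1 j hj hd) h3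

/-- The ordered monomials span all products of brackets. -/
lemma prodSpan_le_span_multiset
    (hB : ∀ I : Idx n, I.len ≤ d → I.assoc ∈ Submodule.span ℝ (range fun x => (a x).assoc))
    (j : ℕ) {w : ℕ} (hw : w ≤ d) :
    prodSpan a j w ≤ Submodule.span ℝ
      ((fun μ : Multiset κ => listProd a μ.toList) '' {μ | listWt a μ.toList = w}) := by
  have key : ∀ l : List κ, listWt a l = w → ∀ j, l.length ≤ j + 1 →
      prodSpan a j w ≤ Submodule.span ℝ
        ((fun μ : Multiset κ => listProd a μ.toList) '' {μ | listWt a μ.toList = w}) →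
      listProd a l ∈ Submodule.span ℝ
        ((fun μ : Multiset κ => listProd a μ.toList) '' {μ | listWt a μ.toList = w}) := by
    intro l hl j hj hle
    have hp : l.Perm (l : Multiset κ).toList := (Multiset.coe_eq_coe.1 (by simp))
    have h1 := hle (by simpa [hl] using listProd_sub_mem_of_perm hB hp j hj (by lia))
    have h2 : listProd a (l : Multiset κ).toList ∈ Submodule.span ℝ
        ((fun μ : Multiset κ => listProd a μ.toList) '' {μ | listWt a μ.toList = w}) :=
      Submodule.subset_span ⟨(l : Multiset κ), by simpa [← listWt_perm a hp] using hl, rfl⟩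
    simpa using add_mem h1 h2
  induction j with
  | zero =>
    rw [prodSpan, Submodule.span_le]
    rintro _ ⟨l, ⟨hl, hl'⟩, rfl⟩
    have hl0 : l = [] := List.eq_nil_of_length_eq_zero (by lia)
    subst hl0
    refine Submodule.subset_span ⟨0, ?_, ?_⟩
    · simpa using hl'
    · simp
  | succ j ih =>
    conv_lhs => rw [prodSpan]
    rw [Submodule.span_le]
    rintro _ ⟨l, ⟨hl, hl'⟩, rfl⟩
    exact key l hl' j hl ih

lemma word_mem_prodSpan
    (hB : ∀ I : Idx n, I.len ≤ d → I.assoc ∈ Submodule.span ℝ (range fun x => (a x).assoc))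
    (w : List (Fin n)) (hw : w.length ≤ d) :
    word w ∈ prodSpan a w.length w.length := by
  induction w with
  | nil => exact listProd_mem_prodSpan []
  | cons i w ih =>
    simp only [List.length_cons] at hw ⊢
    have h1 : FreeAlgebra.ι ℝ i ∈ genSpan a 1 :=
      assoc_mem_genSpan_of_le hB (I := ⟨0, fun _ => i⟩) (le_trans (by simp [Idx.len]) hw)
    have h2 := mul_mem_prodSpan h1 (ih (by lia))
    rw [word_cons]
    rwa [add_comm 1] at h2

/-- The spanning half of the Poincaré–Birkhoff–Witt theorem, in degree at most `d`. -/
lemma exists_eq_linearCombination_listProd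
    (hB : ∀ I : Idx n, I.len ≤ d → I.assoc ∈ Submodule.span ℝ (range fun x => (a x).assoc))
    {P : FreeAlgebra ℝ (Fin n)}
    (hP : P ∈ Submodule.span ℝ (word '' {w | w.length ≤ d})) :
    ∃ c : Multiset κ →₀ ℝ, (∀ μ ∈ c.support, listWt a μ.toList ≤ d) ∧
      Finsupp.linearCombination ℝ (fun μ : Multiset κ => listProd a μ.toList) c = P := by
  have h : P ∈ Submodule.span ℝ
      ((fun μ : Multiset κ => listProd a μ.toList) '' {μ | listWt a μ.toList ≤ d}) := by
    refine Submodule.span_le.2 ?_ hP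
    rintro _ ⟨w, hw, rfl⟩
    refine Submodule.span_mono (image_mono fun μ hμ => ?_)
      (prodSpan_le_span_multiset hB _ hw (word_mem_prodSpan hB w hw))
    exact (show listWt a μ.toList = w.length from hμ).le.trans hw
  obtain ⟨c, hc, rfl⟩ := (Finsupp.mem_span_image_iff_linearCombination ℝ).1 h
  exact ⟨c, fun μ hμ => hc hμ, rfl⟩

end OrderedMonomials

section Operators

variable {n : ℕ} {V : Type*} [NormedAddCommGroup V] [NormedSpace ℝ V]

/-- The differential operator attached to a word, applied to a scalar function. -/
def wordOp (Y : Fin n → V → V) (w : List (Fin n)) (f : V → ℝ) : V → ℝ :=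
  w.foldr (fun i g x => fderiv ℝ g x (Y i x)) f

/-- The differential operator attached to an element of the free algebra, applied to `f` and
evaluated at `x`. -/
def evalOp (Y : Fin n → V → V) (f : V → ℝ) (x : V) : FreeAlgebra ℝ (Fin n) →ₗ[ℝ] ℝ :=
  wordLift fun w => wordOp Y w f x

@[simp] lemma evalOp_word (Y : Fin n → V → V) (f : V → ℝ) (x : V) (w : List (Fin n)) :
    evalOp Y f x (word w) = wordOp Y w f x := wordLift_word _ _

@[simp] lemma evalOp_one (Y : Fin n → V → V) (f : V → ℝ) (x : V) : evalOp Y f x 1 = f x :=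
  evalOp_word Y f x []

lemma contDiffOn_fderiv_apply {S : Set V} (hS : IsOpen S) {j : ℕ} {g : V → ℝ} {Z : V → V}
    (hg : ContDiffOn ℝ (j + 1 : ℕ) g S) (hZ : ContDiffOn ℝ j Z S) :
    ContDiffOn ℝ j (fun x => fderiv ℝ g x (Z x)) S :=
  (hg.fderiv_of_isOpen hS (by norm_cast)).clm_apply hZ

lemma differentiableAt_of_contDiffOn {F : Type*} [NormedAddCommGroup F] [NormedSpace ℝ F]
    {S : Set V} (hS : IsOpen S) {j : ℕ} (hj : 1 ≤ j) {g : V → F} (hg : ContDiffOn ℝ j g S)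
    {x : V} (hx : x ∈ S) : DifferentiableAt ℝ g x :=
  (hg.contDiffAt (hS.mem_nhds hx)).differentiableAt (by norm_cast; lia)

lemma contDiffOn_vComm {S : Set V} (hS : IsOpen S) {j : ℕ} {Y Z : V → V}
    (hY : ContDiffOn ℝ (j + 1 : ℕ) Y S) (hZ : ContDiffOn ℝ (j + 1 : ℕ) Z S) :
    ContDiffOn ℝ j (vComm Y Z) S := by
  have hj : (j : WithTop ℕ∞) ≤ (j + 1 : ℕ) := by norm_cast; lia
  exact ((hZ.fderiv_of_isOpen hS (by norm_cast)).clm_apply (hY.of_le hj)).sub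
    ((hY.fderiv_of_isOpen hS (by norm_cast)).clm_apply (hZ.of_le hj))

/-- A commutator acts on functions as the commutator of the corresponding operators. -/
lemma fderiv_vComm_apply {F : V → ℝ} {Y Z : V → V} {x : V} (hF : ContDiffAt ℝ 2 F x)
    (hY : DifferentiableAt ℝ Y x) (hZ : DifferentiableAt ℝ Z x) :
    fderiv ℝ F x (vComm Y Z x) =
      fderiv ℝ (fun y => fderiv ℝ F y (Z y)) x (Y x) -
        fderiv ℝ (fun y => fderiv ℝ F y (Y y)) x (Z x) := by
  have h1 : DifferentiableAt ℝ (fderiv ℝ F) x :=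
    (hF.fderiv_right (m := 1) (by norm_num)).differentiableAt (by norm_num)
  have h2 : IsSymmSndFDerivAt ℝ F x := hF.isSymmSndFDerivAt (by simp)
  rw [fderiv_clm_apply h1 hZ, fderiv_clm_apply h1 hY]
  simp only [vComm, map_sub, add_apply, ContinuousLinearMap.comp_apply,
    ContinuousLinearMap.flip_apply]
  rw [h2.eq (Y x) (Z x)]
  ring

variable {S : Set V} {r : ℕ} {Y : Fin n → V → V}

lemma contDiffOn_iterComm (hS : IsOpen S) (hY : ∀ i, ContDiffOn ℝ (r - 1 : ℕ) (Y i) S)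
    (k : ℕ) (f : Fin (k + 1) → Fin n) {j : ℕ} (hj : j + (k + 1) ≤ r) :
    ContDiffOn ℝ j (iterComm Y k f) S := by
  induction k generalizing j with
  | zero => exact (hY _).of_le (by norm_cast; lia)
  | succ k ih =>
    exact contDiffOn_vComm hS ((hY _).of_le (by norm_cast; lia)) (ih _ (by lia))

lemma contDiffOn_wordOp (hS : IsOpen S) (hY : ∀ i, ContDiffOn ℝ (r - 1 : ℕ) (Y i) S)
    {f : V → ℝ} (hf : ContDiffOn ℝ r f S) (w : List (Fin n)) {j : ℕ}
    (hj : w.length + j ≤ r) : ContDiffOn ℝ j (wordOp Y w f) S := by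
  induction w generalizing j with
  | nil => exact hf.of_le (by norm_cast; simpa using hj)
  | cons i w ih =>
    simp only [List.length_cons] at hj
    exact contDiffOn_fderiv_apply hS (ih (by lia)) ((hY i).of_le (by norm_cast; lia))

lemma contDiffOn_evalOp (hS : IsOpen S) (hY : ∀ i, ContDiffOn ℝ (r - 1 : ℕ) (Y i) S)
    {f : V → ℝ} (hf : ContDiffOn ℝ r f S) {k j : ℕ} (hj : k + j ≤ r)
    {P : FreeAlgebra ℝ (Fin n)} (hP : P ∈ homog n k) :
    ContDiffOn ℝ j (fun x => evalOp Y f x P) S := by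
  induction hP using Submodule.span_induction with
  | mem x hx =>
    obtain ⟨w, hw, rfl⟩ := hx
    simp only [mem_ofPred_eq] at hw
    simp only [evalOp_word]
    exact contDiffOn_wordOp hS hY hf w (by lia)
  | zero => simpa using contDiffOn_const
  | add x y _ _ hx hy => simpa only [map_add] using hx.add hy
  | smul c x _ hx => simpa only [map_smul] using hx.const_smul c

lemma evalOp_ι_mul (hS : IsOpen S) (hY : ∀ i, ContDiffOn ℝ (r - 1 : ℕ) (Y i) S)
    {f : V → ℝ} (hf : ContDiffOn ℝ r f S) {k : ℕ} (hk : k + 1 ≤ r)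
    {P : FreeAlgebra ℝ (Fin n)} (hP : P ∈ homog n k) (i : Fin n) {x : V} (hx : x ∈ S) :
    evalOp Y f x (FreeAlgebra.ι ℝ i * P) = fderiv ℝ (fun y => evalOp Y f y P) x (Y i x) := by
  have hd : ∀ Q ∈ homog n k, DifferentiableAt ℝ (fun y => evalOp Y f y Q) x := fun Q hQ =>
    differentiableAt_of_contDiffOn hS le_rfl (contDiffOn_evalOp hS hY hf hk hQ) hx
  induction hP using Submodule.span_induction with
  | mem P hP =>
    obtain ⟨w, hw, rfl⟩ := hP
    rw [← word_cons]
    simp only [evalOp_word]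
    rfl
  | zero => simp
  | add P Q hP hQ hP' hQ' =>
    rw [mul_add, map_add, hP', hQ']
    simp only [map_add]
    rw [fderiv_fun_add (hd P hP) (hd Q hQ), add_apply]
  | smul c P hP hP' =>
    rw [mul_smul_comm, map_smul, hP']
    simp only [map_smul, smul_eq_mul]
    rw [fderiv_const_mul (hd P hP)]
    simp

/-- A bracket acts on functions through the iterated commutator. -/
lemma evalOp_assocBracket_mul (hS : IsOpen S) (hY : ∀ i, ContDiffOn ℝ (r - 1 : ℕ) (Y i) S)
    {f : V → ℝ} (hf : ContDiffOn ℝ r f S) (k : ℕ)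
    (g : Fin (k + 1) → Fin n) {q : ℕ} (hq : k + 1 + q ≤ r) {Q : FreeAlgebra ℝ (Fin n)}
    (hQ : Q ∈ homog n q) {x : V} (hx : x ∈ S) :
    evalOp Y f x (assocBracket k g * Q) =
      fderiv ℝ (fun y => evalOp Y f y Q) x (iterComm Y k g x) := by
  induction k generalizing q Q x with
  | zero => exact evalOp_ι_mul hS hY hf (by lia) hQ _ hx
  | succ k ih =>
    have hb := assocBracket_mem_homog k fun j => g j.succ
    have hi := ι_mem_homog (g 0)
    have e1 : fderiv ℝ (fun y => evalOp Y f y (assocBracket k (fun j => g j.succ) * Q)) x =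
        fderiv ℝ (fun y => fderiv ℝ (fun y => evalOp Y f y Q) y
          (iterComm Y k (fun j => g j.succ) y)) x :=
      Filter.EventuallyEq.fderiv_eq <| Filter.mem_of_superset (hS.mem_nhds hx) fun y hy =>
        ih _ (by lia) hQ hy
    have e2 : fderiv ℝ (fun y => evalOp Y f y (FreeAlgebra.ι ℝ (g 0) * Q)) x =
        fderiv ℝ (fun y => fderiv ℝ (fun y => evalOp Y f y Q) y (Y (g 0) y)) x :=
      Filter.EventuallyEq.fderiv_eq <| Filter.mem_of_superset (hS.mem_nhds hx) fun y hy =>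
        evalOp_ι_mul hS hY hf (by lia) hQ _ hy
    have h2 : ContDiffAt ℝ 2 (fun y => evalOp Y f y Q) x :=
      (contDiffOn_evalOp hS hY hf (j := 2) (by lia) hQ).contDiffAt (hS.mem_nhds hx)
    rw [assocBracket, sub_mul, map_sub, mul_assoc, mul_assoc,
      evalOp_ι_mul hS hY hf (by lia) (mul_mem_homog hb hQ) _ hx,
      ih _ (by lia) (mul_mem_homog hi hQ) hx, e1, e2, iterComm,
      fderiv_vComm_apply h2
        (differentiableAt_of_contDiffOn hS (j := r - 1) (by lia) (hY _) hx)
        (differentiableAt_of_contDiffOn hS le_rfl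
          (contDiffOn_iterComm hS hY k _ (by lia)) hx)]

lemma evalOp_assoc_mul (hS : IsOpen S) (hY : ∀ i, ContDiffOn ℝ (r - 1 : ℕ) (Y i) S)
    {f : V → ℝ} (hf : ContDiffOn ℝ r f S) (I : Idx n)
    {q : ℕ} (hq : I.len + q ≤ r) {Q : FreeAlgebra ℝ (Fin n)}
    (hQ : Q ∈ homog n q) {x : V} (hx : x ∈ S) :
    evalOp Y f x (I.assoc * Q) =
      fderiv ℝ (fun y => evalOp Y f y Q) x (iterComm Y I.1 I.2 x) :=
  evalOp_assocBracket_mul hS hY hf I.1 I.2 hq hQ hx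

/-- Acting on a linear form, a bracket returns the component of the iterated commutator. -/
lemma evalOp_assoc_clm (hS : IsOpen S) (hY : ∀ i, ContDiffOn ℝ (r - 1 : ℕ) (Y i) S)
    (φ : V →L[ℝ] ℝ) (I : Idx n) (hI : I.len ≤ r) {x : V} (hx : x ∈ S) :
    evalOp Y φ x I.assoc = φ (iterComm Y I.1 I.2 x) := by
  have h := evalOp_assoc_mul hS hY φ.contDiff.contDiffOn I (q := 0) (by simpa using hI)
    (word_mem_homog []) hx
  simpa using h

lemma evalOp_linearCombination_clm (hS : IsOpen S) (hY : ∀ i, ContDiffOn ℝ (r - 1 : ℕ) (Y i) S)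
    (φ : V →L[ℝ] ℝ) (c : Idx n →₀ ℝ)
    (hc : ∀ I ∈ c.support, I.len ≤ r) {x : V} (hx : x ∈ S) :
    evalOp Y φ x (Finsupp.linearCombination ℝ Idx.assoc c) =
      φ (Finsupp.linearCombination ℝ (fun I : Idx n => iterComm Y I.1 I.2 x) c) := by
  rw [Finsupp.linearCombination_apply, Finsupp.linearCombination_apply, Finsupp.sum, Finsupp.sum,
    map_sum, map_sum]
  refine Finset.sum_congr rfl fun I hI => ?_
  rw [map_smul, map_smul, evalOp_assoc_clm hS hY φ I (hc I hI) hx]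

/-- Relations among brackets in the free algebra hold for the iterated commutators. -/
lemma linearCombination_iterComm_eq_zero (hS : IsOpen S)
    (hY : ∀ i, ContDiffOn ℝ (r - 1 : ℕ) (Y i) S)
    (c : Idx n →₀ ℝ)
    (hc : ∀ I ∈ c.support, I.len ≤ r) (h : Finsupp.linearCombination ℝ Idx.assoc c = 0)
    {x : V} (hx : x ∈ S) :
    Finsupp.linearCombination ℝ (fun I : Idx n => iterComm Y I.1 I.2 x) c = 0 := by
  by_contra h0
  obtain ⟨φ, hφ⟩ := SeparatingDual.exists_ne_zero (R := ℝ) h0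
  apply hφ
  rw [← evalOp_linearCombination_clm hS hY φ c hc hx, h, map_zero]

/-- A product of brackets acting on a power of an affine form. -/
lemma exists_evalOp_listProd_pow (hS : IsOpen S) (hY : ∀ i, ContDiffOn ℝ (r - 1 : ℕ) (Y i) S)
    {κ : Type*} (a : κ → Idx n) (φ : V →L[ℝ] ℝ) (v : V)
    (l : List κ) (hl : listWt a l ≤ r) (m : ℕ) :
    ∃ g : V → ℝ, ContDiffOn ℝ (r - listWt a l : ℕ) g S ∧
      (∀ x ∈ S, evalOp Y (fun y => φ (y - v) ^ (m + l.length)) x (listProd a l) =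
        φ (x - v) ^ m * g x) ∧
      (m.factorial : ℝ) * g v =
        (m + l.length).factorial * (l.map fun y => φ (iterComm Y (a y).1 (a y).2 v)).prod := by
  induction l generalizing m with
  | nil => exact ⟨fun _ => 1, contDiffOn_const, by simp, by simp⟩
  | cons y l ih =>
    rw [listWt_cons] at hl
    have h1 := (a y).one_le_len
    obtain ⟨g, hg, hg1, hg2⟩ := ih (by lia) (m + 1)
    have e : m + 1 + l.length = m + (y :: l).length := by simp only [List.length_cons]; ring
    rw [e] at hg1 hg2
    have hφ : ContDiff ℝ r fun x => φ (x - v) := φ.contDiff.comp (contDiff_id.sub contDiff_const)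
    have hφ' : ∀ x, HasFDerivAt (fun x => φ (x - v)) φ x := fun x =>
      φ.hasFDerivAt.comp x ((hasFDerivAt_id x).sub_const v)
    have hZ : ContDiffOn ℝ (r - listWt a (y :: l) : ℕ) (iterComm Y (a y).1 (a y).2) S :=
      contDiffOn_iterComm hS hY _ _ (by
        rw [listWt_cons]
        simp only [Idx.len] at hl ⊢
        lia)
    have hle : r - listWt a (y :: l) + 1 ≤ r - listWt a l := by rw [listWt_cons]; lia
    refine ⟨fun x => (m + 1) * φ (iterComm Y (a y).1 (a y).2 x) * g x +
      φ (x - v) * fderiv ℝ g x (iterComm Y (a y).1 (a y).2 x), ?_, ?_, ?_⟩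
    · refine ((contDiffOn_const.mul (φ.contDiff.comp_contDiffOn hZ)).mul
        (hg.of_le (by norm_cast; lia))).add ((hφ.contDiffOn.of_le (by norm_cast; lia)).mul
        (contDiffOn_fderiv_apply hS (hg.of_le (by norm_cast)) hZ))
    · intro x hx
      rw [listProd_cons, evalOp_assoc_mul hS hY (hφ.pow _).contDiffOn _ hl
        (listProd_mem_homog a l) hx]
      have e1 : fderiv ℝ (fun z => evalOp Y (fun y => φ (y - v) ^ (m + (l.length + 1))) z
          (listProd a l)) x = fderiv ℝ (fun z => φ (z - v) ^ (m + 1) * g z) x :=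
        Filter.EventuallyEq.fderiv_eq <| Filter.mem_of_superset (hS.mem_nhds hx)
          fun z hz => hg1 z hz
      have hgx : DifferentiableAt ℝ g x := differentiableAt_of_contDiffOn hS (by lia) hg hx
      simp only [List.length_cons]
      have hd : HasFDerivAt (fun z => φ (z - v) ^ (m + 1) * g z) _ x :=
        ((hφ' x).pow (m + 1)).mul hgx.hasFDerivAt
      rw [e1, hd.fderiv]
      simp
      ring
    · rw [Nat.factorial_succ] at hg2
      push_cast at hg2
      simp only [sub_self, map_zero, zero_mul, add_zero, List.map_cons, List.prod_cons]
      linear_combination φ (iterComm Y (a y).1 (a y).2 v) * hg2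

end Operators

section Separation

/-- The part of top degree of a nonzero combination of monomials does not vanish identically. -/
lemma exists_sum_card_eq_ne_zero {κ : Type*} {c : Multiset κ →₀ ℝ} {μ₀ : Multiset κ}
    (h : c μ₀ ≠ 0) :
    ∃ y : κ → ℝ, ∑ μ ∈ c.support with μ.card = μ₀.card, c μ * (μ.map y).prod ≠ 0 := by
  classical
  let Q : MvPolynomial κ ℝ := ∑ μ ∈ c.support with μ.card = μ₀.card,
    MvPolynomial.monomial (Multiset.toFinsupp μ) (c μ)
  have hQ : Q ≠ 0 := by
    intro h0
    have h1 : Q.coeff (Multiset.toFinsupp μ₀) = c μ₀ := by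
      simp only [Q, MvPolynomial.coeff_sum, MvPolynomial.coeff_monomial,
        EmbeddingLike.apply_eq_iff_eq]
      rw [Finset.sum_ite_eq' _ μ₀, if_pos (by simp [h])]
    rw [h0, MvPolynomial.coeff_zero] at h1
    exact h h1.symm
  by_contra! hy
  refine hQ (MvPolynomial.funext fun y => ?_)
  rw [map_zero, ← hy y, map_sum]
  refine Finset.sum_congr rfl fun μ _ => ?_
  rw [MvPolynomial.eval_monomial, Finset.prod_multiset_map_count]
  rfl

variable {n : ℕ} {V : Type*} [NormedAddCommGroup V] [NormedSpace ℝ V]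
  {S : Set V} {r : ℕ} {Y : Fin n → V → V}

/-- If the iterated commutators of length at most `d` are free at `v`, a nonzero differential
operator of order at most `d` is detected at `v` by a power of an affine form. -/
lemma exists_evalOp_pow_ne_zero [FiniteDimensional ℝ V] (hS : IsOpen S)
    (hY : ∀ i, ContDiffOn ℝ (r - 1 : ℕ) (Y i) S) {v : V} (hv : v ∈ S) {d : ℕ} (hd : d ≤ r)
    (hfree : ∀ c : Idx n →₀ ℝ, (∀ I ∈ c.support, I.len ≤ d) →
      Finsupp.linearCombination ℝ (fun I : Idx n => iterComm Y I.1 I.2 v) c = 0 →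
      Finsupp.linearCombination ℝ Idx.assoc c = 0)
    {P : FreeAlgebra ℝ (Fin n)} (hP : P ∈ Submodule.span ℝ (word '' {w | w.length ≤ d}))
    (hP0 : P ≠ 0) :
    ∃ (φ : V →L[ℝ] ℝ) (j : ℕ), j ≤ d ∧ evalOp Y (fun y => φ (y - v) ^ j) v P ≠ 0 := by
  classical
  obtain ⟨κ, b, -, hspan, hli⟩ := exists_linearIndependent' ℝ
    (fun I : {I : Idx n // I.len ≤ d} => I.1.assoc)
  let a : κ → Idx n := fun x => (b x).1
  have hB : ∀ I : Idx n, I.len ≤ d → I.assoc ∈ Submodule.span ℝ (range fun x => (a x).assoc) :=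
    fun I hI => by
      change I.assoc ∈ Submodule.span ℝ (range ((fun I : {I : Idx n // I.len ≤ d} =>
        I.1.assoc) ∘ b))
      rw [hspan]
      exact Submodule.subset_span ⟨⟨I, hI⟩, rfl⟩
  have hli' : LinearIndependent ℝ fun x => iterComm Y (a x).1 (a x).2 v := by
    rw [linearIndependent_iff] at hli ⊢
    intro c hc
    apply hli
    have h1 := hfree (c.mapDomain a) (fun I hI => by
      obtain ⟨x, -, rfl⟩ := Finset.mem_image.1 (Finsupp.mapDomain_support hI)
      exact (b x).2) (by rw [Finsupp.linearCombination_mapDomain]; exact hc)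
    rw [Finsupp.linearCombination_mapDomain] at h1
    exact h1
  obtain ⟨c, hc, rfl⟩ := exists_eq_linearCombination_listProd hB hP
  have hc0 : c ≠ 0 := by rintro rfl; simp at hP0
  obtain ⟨μ₀, hμ₀, hmax⟩ := c.support.exists_max_image Multiset.card
    (Finsupp.support_nonempty_iff.2 hc0)
  obtain ⟨y, hy⟩ := exists_sum_card_eq_ne_zero (Finsupp.mem_support_iff.1 hμ₀)
  obtain ⟨φ₀, hφ₀⟩ := LinearMap.exists_extend ((Module.Basis.span hli').constr ℝ y)
  let φ : V →L[ℝ] ℝ := LinearMap.toContinuousLinearMap φ₀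
  have hφ : ∀ x, φ (iterComm Y (a x).1 (a x).2 v) = y x := fun x => by
    have h := LinearMap.congr_fun hφ₀ (Module.Basis.span hli' x)
    rwa [Module.Basis.constr_basis, LinearMap.comp_apply, Submodule.subtype_apply,
      Module.Basis.span_apply] at h
  have hcard : ∀ μ ∈ c.support, μ.card ≤ d := fun μ hμ => by
    have := (length_le_listWt a μ.toList).trans (hc μ hμ)
    rwa [Multiset.length_toList] at this
  refine ⟨φ, μ₀.card, hcard _ hμ₀, ?_⟩
  have key : ∀ μ ∈ c.support, evalOp Y (fun y => φ (y - v) ^ μ₀.card) v (listProd a μ.toList) =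
      if μ.card = μ₀.card then (μ₀.card.factorial : ℝ) * (μ.map y).prod else 0 := by
    intro μ hμ
    obtain ⟨g, -, hg1, hg2⟩ := exists_evalOp_listProd_pow hS hY a φ v μ.toList
      ((hc μ hμ).trans hd) (μ₀.card - μ.card)
    have h1 : μ₀.card - μ.card + μ.toList.length = μ₀.card := by
      have := hmax μ hμ
      rw [Multiset.length_toList]; lia
    rw [h1] at hg1 hg2
    rw [hg1 v hv, sub_self, map_zero]
    split_ifs with h
    · rw [h, Nat.sub_self] at hg2 ⊢
      simp only [hφ, Nat.factorial_zero, Nat.cast_one, one_mul] at hg2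
      rw [pow_zero, one_mul, hg2, ← Multiset.prod_coe, ← Multiset.map_coe, Multiset.coe_toList]
    · have := hmax μ hμ
      rw [zero_pow (by lia), zero_mul]
  rw [Finsupp.linearCombination_apply, Finsupp.sum, map_sum]
  have e : ∑ μ ∈ c.support, evalOp Y (fun y => φ (y - v) ^ μ₀.card) v
      (c μ • listProd a μ.toList) = (μ₀.card.factorial : ℝ) *
        ∑ μ ∈ c.support with μ.card = μ₀.card, c μ * (μ.map y).prod := by
    rw [Finset.mul_sum, Finset.sum_filter]
    refine Finset.sum_congr rfl fun μ hμ => ?_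
    rw [map_smul, key μ hμ, smul_eq_mul]
    split_ifs
    · ring
    · simp
  rw [e]
  exact mul_ne_zero (by positivity) hy

end Separation

section Lift

variable {n : ℕ}

lemma toAssoc_linearCombination (c : Idx n →₀ ℝ) :
    (toAssoc n : FreeLieAlgebra ℝ (Fin n) →ₗ[ℝ] FreeAlgebra ℝ (Fin n))
      (Finsupp.linearCombination ℝ (fun I : Idx n => freeBracket I.1 I.2) c) =
      Finsupp.linearCombination ℝ Idx.assoc c := by
  rw [Finsupp.apply_linearCombination]
  congr 2
  funext I
  exact toAssoc_freeBracket I.1 I.2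

lemma stripLast_mem_span {i : Fin n} {d k : ℕ} (hk : k ≤ d + 1) {P : FreeAlgebra ℝ (Fin n)}
    (hP : P ∈ homog n k) : stripLast i P ∈ Submodule.span ℝ (word '' {w | w.length ≤ d}) := by
  induction hP using Submodule.span_induction with
  | mem P hP =>
    obtain ⟨w, hw, rfl⟩ := hP
    simp only [mem_ofPred_eq] at hw
    rw [stripLast, wordLift_word]
    split_ifs
    · refine Submodule.subset_span ⟨_, ?_, rfl⟩
      simp only [mem_ofPred_eq, List.length_dropLast]
      lia
    · exact zero_mem _
  | zero => simp
  | add P Q _ _ hP hQ => simpa only [map_add] using add_mem hP hQ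
  | smul c P _ hP => simpa only [map_smul] using Submodule.smul_mem _ c hP

variable {V W : Type*} [NormedAddCommGroup V] [NormedSpace ℝ V] [NormedAddCommGroup W]
  [NormedSpace ℝ W] {S : Set V} {r : ℕ} {Y : Fin n → V → V} {Yt : Fin n → W → W}
  {π : W →L[ℝ] V} {τ : W →L[ℝ] ℝ}

/-- If the system is not free at `v`, some power of an affine form detects a relation. -/
lemma exists_relation_detected [FiniteDimensional ℝ V] (hS : IsOpen S)
    (hY : ∀ i, ContDiffOn ℝ (r - 1 : ℕ) (Y i) S) {v : V} (hv : v ∈ S)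
    (h : ∃ c : Idx n →₀ ℝ, (∀ I ∈ c.support, I.len ≤ r) ∧
      Finsupp.linearCombination ℝ (fun I : Idx n => iterComm Y I.1 I.2 v) c = 0 ∧
      Finsupp.linearCombination ℝ (fun I : Idx n => freeBracket I.1 I.2) c ≠ 0) :
    ∃ (k₀ : Fin n) (φ : V →L[ℝ] ℝ) (j : ℕ) (c : Idx n →₀ ℝ), j ≤ r - 1 ∧
      (∀ I ∈ c.support, I.len ≤ r) ∧
      Finsupp.linearCombination ℝ (fun I : Idx n => iterComm Y I.1 I.2 v) c = 0 ∧
      evalOp Y (fun y => φ (y - v) ^ j) v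
        (stripLast k₀ (Finsupp.linearCombination ℝ Idx.assoc c)) ≠ 0 := by
  classical
  let p : ℕ → Prop := fun s => ∃ c : Idx n →₀ ℝ, (∀ I ∈ c.support, I.len ≤ s) ∧
      Finsupp.linearCombination ℝ (fun I : Idx n => iterComm Y I.1 I.2 v) c = 0 ∧
      Finsupp.linearCombination ℝ (fun I : Idx n => freeBracket I.1 I.2) c ≠ 0
  have hp : ∃ s, p s := ⟨r, h⟩
  have hsr : Nat.find hp ≤ r := Nat.find_min' hp h
  obtain ⟨c, hc, hc0, hc1⟩ := Nat.find_spec hp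
  have hs : Nat.find hp ≠ 0 := by
    intro h0
    rw [h0] at hc
    have : c = 0 := by
      ext I
      by_contra hI
      have := hc I (Finsupp.mem_support_iff.2 hI)
      have := I.one_le_len
      lia
    simp [this] at hc1
  obtain ⟨d, hd⟩ := Nat.exists_eq_succ_of_ne_zero hs
  have hk : ∃ k₀, stripLast k₀ (Finsupp.linearCombination ℝ Idx.assoc c) ≠ 0 := by
    by_contra! h0
    exact hc1 (linearCombination_freeBracket_eq_zero c h0)
  obtain ⟨k₀, hk₀⟩ := hk
  have hmem : stripLast k₀ (Finsupp.linearCombination ℝ Idx.assoc c) ∈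
      Submodule.span ℝ (word '' {w | w.length ≤ d}) := by
    rw [Finsupp.linearCombination_apply, Finsupp.sum, map_sum]
    refine sum_mem fun I hI => ?_
    rw [map_smul]
    exact Submodule.smul_mem _ _ (stripLast_mem_span ((hc I hI).trans hd.le) I.assoc_mem_homog)
  have hfree : ∀ c : Idx n →₀ ℝ, (∀ I ∈ c.support, I.len ≤ d) →
      Finsupp.linearCombination ℝ (fun I : Idx n => iterComm Y I.1 I.2 v) c = 0 →
      Finsupp.linearCombination ℝ Idx.assoc c = 0 := by
    intro c' hc' hc0'
    have := Nat.find_min hp (m := d) (by lia)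
    have h2 : Finsupp.linearCombination ℝ (fun I : Idx n => freeBracket I.1 I.2) c' = 0 := by
      by_contra h3
      exact this ⟨c', hc', hc0', h3⟩
    rw [← toAssoc_linearCombination, h2, map_zero]
  obtain ⟨φ, j, hj, hne⟩ := exists_evalOp_pow_ne_zero hS hY hv (by lia) hfree hmem hk₀
  exact ⟨k₀, φ, j, c, by lia, fun I hI => (hc I hI).trans hsr, hc0, hne⟩

lemma wordOp_zero (w : List (Fin n)) : wordOp Y w (fun _ => 0) = fun _ => 0 := by
  induction w with
  | nil => rfl
  | cons i w ih =>
    change (fun x => fderiv ℝ (wordOp Y w fun _ => 0) x (Y i x)) = _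
    rw [ih]
    simp

lemma wordOp_comp (hS : IsOpen S) (hY : ∀ i, ContDiffOn ℝ (r - 1 : ℕ) (Y i) S)
    (hπ : ∀ k q, π (Yt k q) = Y k (π q)) {f : V → ℝ} (hf : ContDiffOn ℝ r f S)
    (w : List (Fin n)) (hw : w.length ≤ r) {q : W} (hq : π q ∈ S) :
    wordOp Yt w (fun y => f (π y)) q = wordOp Y w f (π q) := by
  induction w generalizing q with
  | nil => rfl
  | cons i w ih =>
    simp only [List.length_cons] at hw
    change fderiv ℝ (wordOp Yt w fun y => f (π y)) q (Yt i q) =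
      fderiv ℝ (wordOp Y w f) (π q) (Y i (π q))
    have e : fderiv ℝ (wordOp Yt w fun y => f (π y)) q = fderiv ℝ (wordOp Y w f ∘ π) q :=
      Filter.EventuallyEq.fderiv_eq <| Filter.mem_of_superset
        ((hS.preimage π.continuous).mem_nhds hq) fun y hy => ih (by lia) hy
    rw [e, fderiv_comp q (differentiableAt_of_contDiffOn hS le_rfl
      (contDiffOn_wordOp hS hY hf w hw) hq) π.differentiableAt, π.fderiv,
      ContinuousLinearMap.comp_apply, hπ]

lemma evalOp_comp (hS : IsOpen S) (hY : ∀ i, ContDiffOn ℝ (r - 1 : ℕ) (Y i) S)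
    (hπ : ∀ k q, π (Yt k q) = Y k (π q)) {f : V → ℝ} (hf : ContDiffOn ℝ r f S)
    {k : ℕ} (hk : k ≤ r) {P : FreeAlgebra ℝ (Fin n)} (hP : P ∈ homog n k) {q : W}
    (hq : π q ∈ S) : evalOp Yt (fun y => f (π y)) q P = evalOp Y f (π q) P := by
  induction hP using Submodule.span_induction with
  | mem P hP =>
    obtain ⟨w, hw, rfl⟩ := hP
    simp only [mem_ofPred_eq] at hw
    rw [evalOp_word, evalOp_word, wordOp_comp hS hY hπ hf w (by lia) hq]
  | zero => simp
  | add P Q _ _ hP hQ => rw [map_add, map_add, hP, hQ]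
  | smul c P _ hP => rw [map_smul, map_smul, hP]

/-- The new component of a lifted operator only sees the last letter `k₀` of each word. -/
lemma evalOp_last (hS : IsOpen S) (hY : ∀ i, ContDiffOn ℝ (r - 1 : ℕ) (Y i) S)
    (hπ : ∀ k q, π (Yt k q) = Y k (π q)) {k₀ : Fin n} {u : V → ℝ} (hu : ContDiffOn ℝ r u S)
    (hτ : ∀ k q, τ (Yt k q) = if k = k₀ then u (π q) else 0) {k : ℕ} (hk : k + 1 ≤ r)
    {P : FreeAlgebra ℝ (Fin n)} (hP : P ∈ homog n (k + 1)) {q : W} (hq : π q ∈ S) :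
    evalOp Yt τ q P = evalOp Y u (π q) (stripLast k₀ P) := by
  induction hP using Submodule.span_induction with
  | mem P hP =>
    obtain ⟨w, hw, rfl⟩ := hP
    simp only [mem_ofPred_eq] at hw
    obtain ⟨w, i, rfl⟩ := List.eq_nil_or_concat' w |>.resolve_left (by rintro rfl; simp at hw)
    simp only [List.length_append, List.length_singleton] at hw
    have e : wordOp Yt (w ++ [i]) τ = wordOp Yt w fun y => if i = k₀ then u (π y) else 0 := by
      rw [wordOp, List.foldr_append]
      simp only [List.foldr_cons, List.foldr_nil, τ.fderiv, hτ]
      rfl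
    rw [evalOp_word, e, word_concat, stripLast_mul_ι]
    split_ifs with h
    · rw [evalOp_word, wordOp_comp hS hY hπ hu w (by lia) hq]
    · rw [map_zero, wordOp_zero]
  | zero => simp
  | add P Q _ _ hP hQ => rw [map_add, map_add, map_add, hP, hQ]
  | smul c P _ hP => rw [map_smul, map_smul, map_smul, hP]

lemma map_iterComm (hS : IsOpen S) (hY : ∀ i, ContDiffOn ℝ (r - 1 : ℕ) (Y i) S)
    (hYt : ∀ i, ContDiffOn ℝ (r - 1 : ℕ) (Yt i) (π ⁻¹' S))
    (hπ : ∀ k q, π (Yt k q) = Y k (π q)) (I : Idx n) (hI : I.len ≤ r) {q : W} (hq : π q ∈ S) :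
    π (iterComm Yt I.1 I.2 q) = iterComm Y I.1 I.2 (π q) := by
  refine (SeparatingDual.eq_iff_forall_dual_eq (R := ℝ)).2 fun ξ => ?_
  rw [← evalOp_assoc_clm hS hY ξ I hI hq, ← evalOp_comp hS hY hπ ξ.contDiff.contDiffOn hI
    I.assoc_mem_homog hq]
  exact (evalOp_assoc_clm (hS.preimage π.continuous) hYt (ξ.comp π) I hI hq).symm

/-- Lifting by one variable keeps the spanning condition if a relation is detected. -/
lemma span_lift_eq_top (hS : IsOpen S) (hY : ∀ i, ContDiffOn ℝ (r - 1 : ℕ) (Y i) S)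
    (hYt : ∀ i, ContDiffOn ℝ (r - 1 : ℕ) (Yt i) (π ⁻¹' S))
    (hπ : ∀ k q, π (Yt k q) = Y k (π q)) {k₀ : Fin n} {u : V → ℝ} (hu : ContDiffOn ℝ r u S)
    (hτ : ∀ k q, τ (Yt k q) = if k = k₀ then u (π q) else 0)
    (hinj : ∀ w, π w = 0 → τ w = 0 → w = 0) {q : W} (hq : π q ∈ S)
    (hspan : Submodule.span ℝ ((fun I : Idx n => iterComm Y I.1 I.2 (π q)) ''
      {I | I.len ≤ r}) = ⊤) {c : Idx n →₀ ℝ} (hc : ∀ I ∈ c.support, I.len ≤ r)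
    (hc0 : Finsupp.linearCombination ℝ (fun I : Idx n => iterComm Y I.1 I.2 (π q)) c = 0)
    (hne : evalOp Y u (π q) (stripLast k₀ (Finsupp.linearCombination ℝ Idx.assoc c)) ≠ 0) :
    Submodule.span ℝ ((fun I : Idx n => iterComm Yt I.1 I.2 q) '' {I | I.len ≤ r}) = ⊤ := by
  set T := Submodule.span ℝ ((fun I : Idx n => iterComm Yt I.1 I.2 q) '' {I | I.len ≤ r})
  set e := Finsupp.linearCombination ℝ (fun I : Idx n => iterComm Yt I.1 I.2 q) c with he
  have heT : e ∈ T := by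
    rw [he, Finsupp.linearCombination_apply]
    exact sum_mem fun I hI => Submodule.smul_mem _ _ (Submodule.subset_span ⟨I, hc I hI, rfl⟩)
  have hπe : π e = 0 := by
    rw [← hc0, he, Finsupp.linearCombination_apply, Finsupp.linearCombination_apply, Finsupp.sum,
      Finsupp.sum, map_sum]
    refine Finset.sum_congr rfl fun I hI => ?_
    rw [map_smul, map_iterComm hS hY hYt hπ I (hc I hI) hq]
  have hτe : τ e ≠ 0 := by
    rw [he, ← evalOp_linearCombination_clm (hS.preimage π.continuous) hYt τ c hc hq]
    convert hne using 1
    rw [Finsupp.linearCombination_apply, Finsupp.sum, map_sum, map_sum, map_sum]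
    refine Finset.sum_congr rfl fun I hI => ?_
    rw [map_smul, map_smul, map_smul, evalOp_last hS hY hπ hu hτ (hc I hI) I.assoc_mem_homog hq]
  have hmap : T.map (π : W →ₗ[ℝ] V) = ⊤ := by
    rw [eq_top_iff, ← hspan, Submodule.span_le]
    rintro _ ⟨I, hI, rfl⟩
    exact ⟨_, Submodule.subset_span ⟨I, hI, rfl⟩, map_iterComm hS hY hYt hπ I hI hq⟩
  refine eq_top_iff.2 fun w _ => ?_
  obtain ⟨t, ht, htw⟩ : π w ∈ T.map (π : W →ₗ[ℝ] V) := hmap ▸ Submodule.mem_top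
  have hw : w - (t + (τ (w - t) / τ e) • e) = 0 := by
    apply hinj
    · simp only [map_sub, map_add, map_smul, hπe]
      rw [← htw]
      simp
    · simp only [map_sub, map_add, map_smul, smul_eq_mul]
      field_simp
      ring
  rw [sub_eq_zero.1 hw]
  exact add_mem ht (Submodule.smul_mem _ _ heT)

end Lift

section LocalPersistence

variable {n r : ℕ}

/-- A bounded multiindex as a multiindex. -/
def toIdx (I : MIdx (Fin n) r) : Idx n := ⟨I.1.1, I.2⟩

lemma len_toIdx_le (I : MIdx (Fin n) r) : (toIdx I).len ≤ r := I.1.2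

lemma range_comp_toIdx {M : Type*} (g : Idx n → M) :
    range (fun I : MIdx (Fin n) r => g (toIdx I)) = g '' {I | I.len ≤ r} := by
  ext x
  constructor
  · rintro ⟨I, rfl⟩
    exact ⟨_, len_toIdx_le I, rfl⟩
  · rintro ⟨I, hI, rfl⟩
    exact ⟨(⟨⟨I.1, hI⟩, I.2⟩ : Σ k : Fin r, (Fin (k.1 + 1) → Fin n)), rfl⟩

/-- The finitely supported function on multiindices attached to a coefficient family. -/
def toFinsuppIdx (c : MIdx (Fin n) r → ℝ) : Idx n →₀ ℝ :=
  (Finsupp.equivFunOnFinite.symm c).mapDomain toIdx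

lemma len_le_of_mem_support (c : MIdx (Fin n) r → ℝ) :
    ∀ I ∈ (toFinsuppIdx c).support, I.len ≤ r := by
  classical
  intro I hI
  obtain ⟨J, -, rfl⟩ := Finset.mem_image.1 (Finsupp.mapDomain_support hI)
  exact len_toIdx_le J

lemma linearCombination_toFinsuppIdx {M : Type*} [AddCommGroup M] [Module ℝ M] (g : Idx n → M)
    (c : MIdx (Fin n) r → ℝ) :
    Finsupp.linearCombination ℝ g (toFinsuppIdx c) = ∑ I, c I • g (toIdx I) := by
  rw [toFinsuppIdx, Finsupp.linearCombination_mapDomain, Finsupp.linearCombination_apply,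
    Finsupp.sum_fintype _ _ (by simp)]
  rfl

lemma hormSpan_one_iff {V : Type*} [NormedAddCommGroup V] [NormedSpace ℝ V] {Y : Fin n → V → V}
    {S : Set V} : HormSpan Y (fun _ => 1) r S ↔ ∀ x ∈ S,
      Submodule.span ℝ (range fun I : MIdx (Fin n) r => commOf Y I x) = ⊤ := by
  have h : ∀ x, {v : V | ∃ I : MIdx (Fin n) r, wtOf (fun _ => 1) I ≤ r ∧ v = commOf Y I x} =
      range fun I : MIdx (Fin n) r => commOf Y I x := by
    intro x
    ext v
    constructor
    · rintro ⟨I, -, rfl⟩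
      exact ⟨I, rfl⟩
    · rintro ⟨I, rfl⟩
      refine ⟨I, ?_, rfl⟩
      simp [wtOf]
  simp only [HormSpan, h]

variable {V : Type*} [NormedAddCommGroup V] [NormedSpace ℝ V] [FiniteDimensional ℝ V]
  {S : Set V} {Y : Fin n → V → V}

lemma eventually_span_eq_top (hS : IsOpen S) (hY : ∀ i, ContDiffOn ℝ (r - 1 : ℕ) (Y i) S)
    {v : V} (hv : v ∈ S)
    (hspan : Submodule.span ℝ (range fun I : MIdx (Fin n) r => commOf Y I v) = ⊤) :
    ∀ᶠ x in 𝓝 v, Submodule.span ℝ (range fun I : MIdx (Fin n) r => commOf Y I x) = ⊤ := by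
  obtain ⟨κ, a, ha, hs, hli⟩ := exists_linearIndependent' ℝ
    (fun I : MIdx (Fin n) r => commOf Y I v)
  have := Finite.of_injective a ha
  have := Fintype.ofFinite κ
  have hcard : Fintype.card κ = Module.finrank ℝ V := by
    rw [← finrank_span_eq_card hli, hs, hspan, finrank_top]
  have hcont : Filter.Tendsto (fun x i => commOf Y (a i) x) (𝓝 v)
      (𝓝 fun i => commOf Y (a i) v) := by
    refine tendsto_pi_nhds.2 fun i => ?_
    have h := contDiffOn_iterComm hS hY (toIdx (a i)).1 (toIdx (a i)).2 (j := 0)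
      ((zero_add _).trans_le (len_toIdx_le (a i)))
    exact (h.continuousOn.continuousAt (hS.mem_nhds hv)).tendsto
  filter_upwards [hcont.eventually (LinearIndependent.eventually hli)] with x hx
  rw [eq_top_iff, ← hx.span_eq_top_of_card_eq_finrank' hcard]
  refine Submodule.span_mono ?_
  rintro _ ⟨i, rfl⟩
  exact ⟨a i, rfl⟩

/-- Spanning and freeness at a point persist in a neighborhood. -/
lemma exists_nhds_free_hormSpan (hS : IsOpen S) (hY : ∀ i, ContDiffOn ℝ (r - 1 : ℕ) (Y i) S)
    {v : V} (hv : v ∈ S)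
    (hspan : Submodule.span ℝ ((fun I : Idx n => iterComm Y I.1 I.2 v) '' {I | I.len ≤ r}) = ⊤)
    (hfree : ∀ c : Idx n →₀ ℝ, (∀ I ∈ c.support, I.len ≤ r) →
      Finsupp.linearCombination ℝ (fun I : Idx n => iterComm Y I.1 I.2 v) c = 0 →
      Finsupp.linearCombination ℝ (fun I : Idx n => freeBracket I.1 I.2) c = 0) :
    ∃ N ∈ 𝓝 v, N ⊆ S ∧ FreeUpTo Y r N ∧ HormSpan Y (fun _ => 1) r N := by
  rw [← range_comp_toIdx] at hspan
  have hev := eventually_span_eq_top hS hY hv hspan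
  refine ⟨S ∩ {x | Submodule.span ℝ (range fun I : MIdx (Fin n) r => commOf Y I x) = ⊤},
    Filter.inter_mem (hS.mem_nhds hv) hev, inter_subset_left, ?_,
    hormSpan_one_iff.2 fun x hx => hx.2⟩
  rintro x ⟨hxS, hx⟩ c hc
  let L : V → (MIdx (Fin n) r → ℝ) →ₗ[ℝ] V := fun y =>
    Fintype.linearCombination ℝ fun I : MIdx (Fin n) r => commOf Y I y
  have hfree' : ∀ b : MIdx (Fin n) r → ℝ, L v b = 0 → ∑ I, b I • freeBracketOf I = 0 := by
    intro b hb
    have h := hfree (toFinsuppIdx b) (len_le_of_mem_support b)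
    rw [linearCombination_toFinsuppIdx, linearCombination_toFinsuppIdx] at h
    exact h hb
  have hle : LinearMap.ker (L v) ≤ LinearMap.ker (L x) := by
    intro b hb
    have h1 := hfree' b hb
    have h2 := toAssoc_linearCombination (toFinsuppIdx b)
    rw [linearCombination_toFinsuppIdx (fun I : Idx n => freeBracket I.1 I.2)] at h2
    have h3 := linearCombination_iterComm_eq_zero hS hY (toFinsuppIdx b)
      (len_le_of_mem_support b) (h2.symm.trans ((congrArg _ h1).trans (map_zero _))) hxS
    rw [linearCombination_toFinsuppIdx] at h3
    exact h3
  have hrank : ∀ y, Submodule.span ℝ (range fun I : MIdx (Fin n) r => commOf Y I y) = ⊤ →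
      Module.finrank ℝ V + Module.finrank ℝ (LinearMap.ker (L y)) =
        Module.finrank ℝ (MIdx (Fin n) r → ℝ) := by
    intro y hy
    have h := (L y).finrank_range_add_finrank_ker
    rwa [Fintype.range_linearCombination, hy, finrank_top] at h
  have hker : LinearMap.ker (L v) = LinearMap.ker (L x) :=
    Submodule.eq_of_le_of_finrank_eq hle
      (Nat.add_left_cancel ((hrank v hspan).trans (hrank x hx).symm))
  have hcv : c ∈ LinearMap.ker (L v) := hker ▸ hc
  rw [hfree' c hcv]
  exact zero_mem _

end LocalPersistence

section Iteration

variable {p n r m : ℕ}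

/-- The lift of the fields `X` with polynomial components `P` along the added variables. -/
def liftField (X : Fin n → E p → E p) (P : Fin n → Fin m → MvPolynomial (Fin p ⊕ Fin m) ℝ)
    (k : Fin n) (q : E p × (Fin m → ℝ)) : E p × (Fin m → ℝ) :=
  (X k q.1, fun j =>
    MvPolynomial.eval (Sum.elim (fun i => q.1 i) (fun jj => q.2 jj)) (P k j))

lemma contDiff_eval (P : MvPolynomial (Fin p ⊕ Fin m) ℝ) (N : ℕ) :
    ContDiff ℝ N fun q : E p × (Fin m → ℝ) =>
      MvPolynomial.eval (Sum.elim (fun i => q.1 i) (fun jj => q.2 jj)) P := by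
  induction P using MvPolynomial.induction_on with
  | C a => simpa using contDiff_const
  | add P Q hP hQ => simpa only [map_add] using hP.add hQ
  | mul_X P i hP =>
    simp only [map_mul, MvPolynomial.eval_X]
    refine hP.mul ?_
    rcases i with i | i
    · simp only [Sum.elim_inl]
      fun_prop
    · simp only [Sum.elim_inr]
      fun_prop

lemma contDiffOn_liftField {Ω : Set (E p)} {X : Fin n → E p → E p} {N : ℕ}
    (hX : ∀ i, ContDiffOn ℝ N (X i) Ω)
    (P : Fin n → Fin m → MvPolynomial (Fin p ⊕ Fin m) ℝ) (k : Fin n) :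
    ContDiffOn ℝ N (liftField X P k) (Prod.fst ⁻¹' Ω) :=
  ((hX k).comp contDiff_fst.contDiffOn fun _ hq => hq).prodMk
    (contDiff_pi.2 fun j => contDiff_eval (P k j) N).contDiffOn

/-- Affine forms are polynomials of degree at most one. -/
lemma exists_affine_polynomial (φ : E p × (Fin m → ℝ) →L[ℝ] ℝ) (v : E p × (Fin m → ℝ)) :
    ∃ A : MvPolynomial (Fin p ⊕ Fin m) ℝ, A.totalDegree ≤ 1 ∧ ∀ q : E p × (Fin m → ℝ),
      MvPolynomial.eval (Sum.elim (fun i => q.1 i) (fun jj => q.2 jj)) A = φ (q - v) := by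
  let φ₁ : (Fin p → ℝ) →ₗ[ℝ] ℝ := (φ : E p × (Fin m → ℝ) →ₗ[ℝ] ℝ) ∘ₗ
    LinearMap.inl ℝ (E p) (Fin m → ℝ) ∘ₗ (WithLp.linearEquiv 2 ℝ (Fin p → ℝ)).symm.toLinearMap
  let φ₂ : (Fin m → ℝ) →ₗ[ℝ] ℝ := (φ : E p × (Fin m → ℝ) →ₗ[ℝ] ℝ) ∘ₗ
    LinearMap.inr ℝ (E p) (Fin m → ℝ)
  have hφ : ∀ q, φ q = φ₁ (fun i => q.1 i) + φ₂ q.2 := by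
    intro q
    change φ q = φ (q.1, 0) + φ (0, q.2)
    rw [← map_add]
    simp
  have hdeg : ∀ (a : ℝ) (i : Fin p ⊕ Fin m),
      (MvPolynomial.C a * MvPolynomial.X i : MvPolynomial (Fin p ⊕ Fin m) ℝ).totalDegree ≤ 1 :=
    fun a i => (MvPolynomial.totalDegree_mul _ _).trans (by simp)
  refine ⟨∑ i, MvPolynomial.C (φ₁ fun j => if i = j then 1 else 0) * MvPolynomial.X (Sum.inl i) +
    ∑ i, MvPolynomial.C (φ₂ fun j => if i = j then 1 else 0) * MvPolynomial.X (Sum.inr i) -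
    MvPolynomial.C (φ v), ?_, fun q => ?_⟩
  · refine (MvPolynomial.totalDegree_sub _ _).trans (max_le ?_ (by simp))
    refine (MvPolynomial.totalDegree_add _ _).trans (max_le ?_ ?_) <;>
    exact MvPolynomial.totalDegree_finsetSum_le fun i _ => hdeg _ _
  · rw [map_sub φ, hφ q, φ₁.pi_apply_eq_sum_univ, φ₂.pi_apply_eq_sum_univ]
    simp [mul_comm]

variable {Ω : Set (E p)} {X : Fin n → E p → E p} {x₀ : E p}

/-- Forgetting the last added variable. -/
def forgetLast (p m : ℕ) : E p × (Fin (m + 1) → ℝ) →L[ℝ] E p × (Fin m → ℝ) :=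
  (ContinuousLinearMap.fst ℝ _ _).prod
    ((ContinuousLinearMap.pi fun j : Fin m => ContinuousLinearMap.proj j.castSucc).comp
      (ContinuousLinearMap.snd ℝ _ _))

/-- The last added variable. -/
def lastCoord (p m : ℕ) : E p × (Fin (m + 1) → ℝ) →L[ℝ] ℝ :=
  (ContinuousLinearMap.proj (Fin.last m)).comp (ContinuousLinearMap.snd ℝ _ _)

/-- A spanning lift with polynomial components of degree at most `r - 1`. -/
def IsSpanningLift (r : ℕ) (X : Fin n → E p → E p) (x₀ : E p)
    (P : Fin n → Fin m → MvPolynomial (Fin p ⊕ Fin m) ℝ) : Prop :=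
  (∀ k j, (P k j).totalDegree ≤ r - 1) ∧
    Submodule.span ℝ ((fun I : Idx n => iterComm (liftField X P) I.1 I.2 (x₀, 0)) ''
      {I | I.len ≤ r}) = ⊤

/-- A spanning lift which is not free can be lifted further. -/
lemma exists_isSpanningLift_succ (hΩ : IsOpen Ω) (hX : ∀ i, ContDiffOn ℝ (r - 1 : ℕ) (X i) Ω)
    (hx₀ : x₀ ∈ Ω) {P : Fin n → Fin m → MvPolynomial (Fin p ⊕ Fin m) ℝ}
    (hP : IsSpanningLift r X x₀ P)
    (h : ∃ c : Idx n →₀ ℝ, (∀ I ∈ c.support, I.len ≤ r) ∧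
      Finsupp.linearCombination ℝ
        (fun I : Idx n => iterComm (liftField X P) I.1 I.2 (x₀, 0)) c = 0 ∧
      Finsupp.linearCombination ℝ (fun I : Idx n => freeBracket I.1 I.2) c ≠ 0) :
    ∃ P' : Fin n → Fin (m + 1) → MvPolynomial (Fin p ⊕ Fin (m + 1)) ℝ,
      IsSpanningLift r X x₀ P' := by
  have hS : IsOpen (Prod.fst ⁻¹' Ω : Set (E p × (Fin m → ℝ))) := hΩ.preimage continuous_fst
  obtain ⟨k₀, φ, j, c, hj, hc, hc0, hne⟩ := exists_relation_detected hS
    (contDiffOn_liftField hX P) (v := (x₀, 0)) hx₀ h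
  obtain ⟨A, hA, hA'⟩ := exists_affine_polynomial φ (x₀, 0)
  let B : Fin n → MvPolynomial (Fin p ⊕ Fin m) ℝ := fun k => if k = k₀ then A ^ j else 0
  let P' : Fin n → Fin (m + 1) → MvPolynomial (Fin p ⊕ Fin (m + 1)) ℝ := fun k i =>
    MvPolynomial.rename (Sum.map id Fin.castSucc)
      (Fin.snoc (α := fun _ => MvPolynomial (Fin p ⊕ Fin m) ℝ) (P k) (B k) i)
  have heval : ∀ (q : E p × (Fin (m + 1) → ℝ)) (Q : MvPolynomial (Fin p ⊕ Fin m) ℝ),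
      MvPolynomial.eval (Sum.elim (fun i => q.1 i) (fun jj => q.2 jj))
        (MvPolynomial.rename (Sum.map id Fin.castSucc) Q) =
      MvPolynomial.eval (Sum.elim (fun i => (forgetLast p m q).1 i)
        (fun jj => (forgetLast p m q).2 jj)) Q := by
    intro q Q
    rw [MvPolynomial.eval_rename]
    congr 1
    congr 1
    funext i
    rcases i with i | i <;> rfl
  refine ⟨P', fun k i => ?_, ?_⟩
  · refine (MvPolynomial.totalDegree_rename_le _ _).trans ?_
    refine Fin.lastCases ?_ (fun i => ?_) i
    · rw [Fin.snoc_last]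
      simp only [B]
      split_ifs
      · refine (MvPolynomial.totalDegree_pow _ _).trans ?_
        exact (Nat.mul_le_mul_left j hA).trans (by lia)
      · simp
    · rw [Fin.snoc_castSucc]
      exact hP.1 k i
  · have hq : forgetLast p m (x₀, 0) = (x₀, 0) := rfl
    refine span_lift_eq_top (π := forgetLast p m) (τ := lastCoord p m)
      (u := fun y => φ (y - (x₀, 0)) ^ j) (k₀ := k₀) (c := c) hS (contDiffOn_liftField hX P)
      (contDiffOn_liftField hX P') ?_ ?_ ?_ ?_ hx₀ (by rw [hq]; exact hP.2) hc
      (by rw [hq]; exact hc0) (by rw [hq]; exact hne)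
    · intro k q
      refine Prod.ext rfl (funext fun i => ?_)
      change MvPolynomial.eval _ (P' k i.castSucc) = _
      simp only [P', Fin.snoc_castSucc]
      exact heval q _
    · exact ((φ.contDiff.comp (contDiff_id.sub contDiff_const)).pow j).contDiffOn
    · intro k q
      change MvPolynomial.eval _ (P' k (Fin.last m)) = _
      simp only [P', Fin.snoc_last]
      rw [heval q]
      simp only [B]
      split_ifs
      · rw [map_pow, hA']
      · exact map_zero _
    · intro w h1 h2
      have h3 := Prod.ext_iff.1 h1
      refine Prod.ext h3.1 (funext fun i => ?_)
      refine Fin.lastCases h2 (fun i => ?_) i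
      exact congrFun h3.2 i

lemma exists_isSpanningLift_zero (hΩ : IsOpen Ω) (hX : ∀ i, ContDiffOn ℝ (r - 1 : ℕ) (X i) Ω)
    (hx₀ : x₀ ∈ Ω)
    (hspan : Submodule.span ℝ (range fun I : MIdx (Fin n) r => commOf X I x₀) = ⊤) :
    ∃ P : Fin n → Fin 0 → MvPolynomial (Fin p ⊕ Fin 0) ℝ, IsSpanningLift r X x₀ P := by
  refine ⟨fun _ j => j.elim0, fun _ j => j.elim0, eq_top_iff.2 fun w _ => ?_⟩
  set T := Submodule.span ℝ ((fun I : Idx n =>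
    iterComm (liftField X fun _ (j : Fin 0) => j.elim0) I.1 I.2 (x₀, 0)) '' {I | I.len ≤ r})
  have hmap : T.map (LinearMap.fst ℝ (E p) (Fin 0 → ℝ)) = ⊤ := by
    rw [eq_top_iff, ← hspan, Submodule.span_le]
    rintro _ ⟨I, rfl⟩
    exact ⟨_, Submodule.subset_span ⟨toIdx I, len_toIdx_le I, rfl⟩,
      map_iterComm (π := ContinuousLinearMap.fst ℝ (E p) (Fin 0 → ℝ)) hΩ hX
        (contDiffOn_liftField hX _) (fun _ _ => rfl) (toIdx I) (len_toIdx_le I) hx₀⟩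
  obtain ⟨t, ht, htw⟩ : w.1 ∈ T.map (LinearMap.fst ℝ (E p) (Fin 0 → ℝ)) :=
    hmap ▸ Submodule.mem_top
  have : t = w := Prod.ext htw (Subsingleton.elim _ _)
  exact this ▸ ht

lemma IsSpanningLift.le_card {P : Fin n → Fin m → MvPolynomial (Fin p ⊕ Fin m) ℝ}
    (hP : IsSpanningLift r X x₀ P) : m ≤ Fintype.card (MIdx (Fin n) r) := by
  have h := finrank_range_le_card (R := ℝ)
    fun I : MIdx (Fin n) r => commOf (liftField X P) I (x₀, 0)
  have h2 := hP.2
  rw [← range_comp_toIdx] at h2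
  change Module.finrank ℝ (Submodule.span ℝ _) ≤ _ at h
  change Submodule.span ℝ (range fun I : MIdx (Fin n) r =>
    commOf (liftField X P) I (x₀, 0)) = ⊤ at h2
  rw [h2, finrank_top, Module.finrank_prod, Module.finrank_fin_fun] at h
  lia

/-- Lifting as long as possible yields a system that is free at the base point. -/
lemma exists_isSpanningLift_free (hΩ : IsOpen Ω) (hX : ∀ i, ContDiffOn ℝ (r - 1 : ℕ) (X i) Ω)
    (hx₀ : x₀ ∈ Ω)
    (hspan : Submodule.span ℝ (range fun I : MIdx (Fin n) r => commOf X I x₀) = ⊤) :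
    ∃ (m : ℕ) (P : Fin n → Fin m → MvPolynomial (Fin p ⊕ Fin m) ℝ), IsSpanningLift r X x₀ P ∧
      ∀ c : Idx n →₀ ℝ, (∀ I ∈ c.support, I.len ≤ r) →
        Finsupp.linearCombination ℝ
          (fun I : Idx n => iterComm (liftField X P) I.1 I.2 (x₀, 0)) c = 0 →
        Finsupp.linearCombination ℝ (fun I : Idx n => freeBracket I.1 I.2) c = 0 := by
  by_contra! h
  have hall : ∀ m : ℕ, ∃ P : Fin n → Fin m → MvPolynomial (Fin p ⊕ Fin m) ℝ,
      IsSpanningLift r X x₀ P := by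
    intro m
    induction m with
    | zero => exact exists_isSpanningLift_zero hΩ hX hx₀ hspan
    | succ m ih =>
      obtain ⟨P, hP⟩ := ih
      exact exists_isSpanningLift_succ hΩ hX hx₀ hP (h m P hP)
  obtain ⟨P, hP⟩ := hall (Fintype.card (MIdx (Fin n) r) + 1)
  have := hP.le_card
  lia

end Iteration

end Lifting

/-- Lifting theorem for nonsmooth vector fields. With
`X_0 ≡ 0` and `C^{r-1}` coefficients satisfying Hörmander's condition of step
`r`, every `x₀ ∈ Ω` has a neighborhood `U` on which the `X_k`'s can be lifted to
free (up to step `r`) Hörmander vector fields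
`X̃_k = X_k + Σ_j u_{kj}(x,t) ∂_{t_j}` on `U × I ⊆ ℝ^{p+m}`, with the `u_{kj}`
polynomials of degree at most `r-1`. -/
theorem lifting_theorem
    (p n r : ℕ) (hr : 2 ≤ r) (hnp : n < p)
    (Ω : Set (E p)) (hΩo : IsOpen Ω) (hΩconn : IsConnected Ω)
    (hΩb : Bornology.IsBounded Ω)
    (X : Fin n → E p → E p)
    (hXreg : ∀ i, ContDiffOn ℝ (r - 1 : ℕ) (X i) (closure Ω))
    (hHor : HormSpan X (fun _ => 1) r Ω) :
    ∀ x₀ ∈ Ω, ∃ (U : Set (E p)) (m : ℕ) (I0 : Set (Fin m → ℝ))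
      (u : Fin n → Fin m → E p × (Fin m → ℝ) → ℝ)
      (Xt : Fin n → E p × (Fin m → ℝ) → E p × (Fin m → ℝ)),
      IsOpen U ∧ x₀ ∈ U ∧ U ⊆ Ω ∧ IsOpen I0 ∧ (0 : Fin m → ℝ) ∈ I0 ∧
      (∀ k q, Xt k q = (X k q.1, fun j => u k j q)) ∧
      (∀ k j, ∃ P : MvPolynomial (Fin p ⊕ Fin m) ℝ, P.totalDegree ≤ r - 1 ∧
        ∀ q : E p × (Fin m → ℝ), u k j q =
          MvPolynomial.eval (Sum.elim (fun i => q.1 i) (fun jj => q.2 jj)) P) ∧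
      FreeUpTo Xt r (U ×ˢ I0) ∧
      HormSpan Xt (fun _ => 1) r (U ×ˢ I0) := by
  intro x₀ hx₀
  have hX : ∀ i, ContDiffOn ℝ (r - 1 : ℕ) (X i) Ω := fun i => (hXreg i).mono subset_closure
  obtain ⟨m, P, hP, hfree⟩ := Lifting.exists_isSpanningLift_free hΩo hX hx₀
    (Lifting.hormSpan_one_iff.1 hHor x₀ hx₀)
  obtain ⟨N, hN, hNS, hNfree, hNspan⟩ := Lifting.exists_nhds_free_hormSpan
    (hΩo.preimage continuous_fst) (Lifting.contDiffOn_liftField hX P) (v := (x₀, 0)) hx₀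
    hP.2 hfree
  obtain ⟨U, I0, hU, hxU, hI0, h0, hsub⟩ := mem_nhds_prod_iff'.1 hN
  exact ⟨U, m, I0, fun k j q => (Lifting.liftField X P k q).2 j, Lifting.liftField X P, hU, hxU,
    fun x hx => hNS (hsub (mk_mem_prod hx h0)), hI0, h0, fun _ _ => rfl,
    fun k j => ⟨P k j, hP.1 k j, fun _ => rfl⟩,
    fun q hq => hNfree q (hsub hq), fun q hq => hNspan q (hsub hq)⟩

end
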